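/- arXiv:2005.09717 — 6 statements merged into one kernel-verified Lean document; each statement's English description precedes it below -/
import Mathlib

section
/- Let X be a real random variable such that P(|X| ≥ x) ≤ D·e^{−x²/(2σ²)} for all x>0, for some constants D>0 and σ²>0. Then for every s>0, E[e^{sX}] ≤ 1 + D√(2π)·sσ·e^{s²σ²/2}, and furthermore for every s>0 and every k>0, E[e^{sX}] ≤ (1 + D√(k/e)·√(2π)) · e^{(1/2 + 1/(2k))·s²σ²}. -/
open MeasureTheory

noncomputable section

namespace TRDT

lemma aux_int (s σ D : ℝ) (hs : 0 < s) (hD : 0 < D) (hσ : 0 < σ) :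
    ∫⁻ t : ℝ, ENNReal.ofReal (D * Real.exp (-(t ^ 2) / (2 * σ ^ 2)))
        * ENNReal.ofReal (s * Real.exp (s * t))
      = ENNReal.ofReal (D * Real.sqrt (2 * Real.pi) * s * σ * Real.exp (s ^ 2 * σ ^ 2 / 2)) := by
  obtain ⟨v, hvσ⟩ : ∃ v : NNReal, (v : ℝ) = σ ^ 2 :=
    ⟨Real.toNNReal (σ ^ 2), Real.coe_toNNReal _ (sq_nonneg σ)⟩
  have hv : v ≠ 0 := by
    rintro rfl
    exact (pow_pos hσ 2).ne' (by simpa using hvσ.symm)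
  have key : ∀ t : ℝ, ENNReal.ofReal (D * Real.exp (-(t ^ 2) / (2 * σ ^ 2)))
        * ENNReal.ofReal (s * Real.exp (s * t)) =
      ENNReal.ofReal (D * Real.sqrt (2 * Real.pi) * s * σ * Real.exp (s ^ 2 * σ ^ 2 / 2))
        * ProbabilityTheory.gaussianPDF (s * σ ^ 2) v t := by
    intro t
    rw [ProbabilityTheory.gaussianPDF_def, ProbabilityTheory.gaussianPDFReal_def, hvσ,
      ← ENNReal.ofReal_mul (by positivity), ← ENNReal.ofReal_mul (by positivity)]
    congr 1
    change _ = _ * ((Real.sqrt (2 * Real.pi * σ ^ 2))⁻¹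
      * Real.exp (-(t - s * σ ^ 2) ^ 2 / (2 * σ ^ 2)))
    have h1 : Real.sqrt (2 * Real.pi * σ ^ 2) = Real.sqrt (2 * Real.pi) * σ := by
      rw [Real.sqrt_mul (by positivity), Real.sqrt_sq hσ.le]
    have h2 : Real.exp (-(t ^ 2) / (2 * σ ^ 2)) * Real.exp (s * t)
        = Real.exp (s ^ 2 * σ ^ 2 / 2) * Real.exp (-(t - s * σ ^ 2) ^ 2 / (2 * σ ^ 2)) := by
      rw [← Real.exp_add, ← Real.exp_add]
      congr 1
      field_simp
      ring
    have h3 : Real.sqrt (2 * Real.pi) ≠ 0 := by positivity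
    rw [h1]
    calc _ = D * s * (Real.exp (-(t ^ 2) / (2 * σ ^ 2)) * Real.exp (s * t)) := by ring
      _ = _ := by
        rw [h2]
        field_simp
  simp_rw [key]
  rw [lintegral_const_mul _ (ProbabilityTheory.measurable_gaussianPDF _ _),
    ProbabilityTheory.lintegral_gaussianPDF_eq_one _ hv, mul_one]

lemma aux_real (a k D : ℝ) (hD : 0 < D) (hk : 0 < k) :
    1 + D * Real.sqrt (2 * Real.pi) * a * Real.exp (a ^ 2 / 2) ≤
      (1 + D * Real.sqrt (k / Real.exp 1) * Real.sqrt (2 * Real.pi))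
                * Real.exp ((1 / 2 + 1 / (2 * k)) * a ^ 2) := by
  have h1 : a ≤ Real.sqrt (k / Real.exp 1) * Real.exp (a ^ 2 / (2 * k)) := by
    refine le_of_abs_le (abs_le_of_sq_le_sq ?_ (by positivity))
    rw [mul_pow, Real.sq_sqrt (by positivity), ← Real.exp_nat_mul]
    have := Real.add_one_le_exp (a ^ 2 / k - 1)
    rw [Real.exp_sub, sub_add_cancel] at this
    have h := mul_le_mul_of_nonneg_left this hk.le
    have e1 : k * (a ^ 2 / k) = a ^ 2 := by field_simp
    have e2 : ((2 : ℕ) : ℝ) * (a ^ 2 / (2 * k)) = a ^ 2 / k := by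
      push_cast
      field_simp
    rw [e2]
    rw [e1] at h
    calc a ^ 2 ≤ _ := h
      _ = _ := by ring
  have h2 : (1:ℝ) ≤ Real.exp ((1 / 2 + 1 / (2 * k)) * a ^ 2) := Real.one_le_exp (by positivity)
  have h3 : Real.exp ((1 / 2 + 1 / (2 * k)) * a ^ 2)
      = Real.exp (a ^ 2 / (2 * k)) * Real.exp (a ^ 2 / 2) := by
    rw [← Real.exp_add]
    congr 1
    field_simp
    ring
  have h4 := mul_le_mul_of_nonneg_left h1
    (show 0 ≤ D * Real.sqrt (2 * Real.pi) * Real.exp (a ^ 2 / 2) by positivity)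
  rw [add_mul, one_mul]
  refine add_le_add h2 ?_
  rw [h3]
  linarith


/-- Lemma A.1 of the paper: if `X` is sub-Gaussian, i.e. `P(|X| ≥ x) ≤ D·e^{−x²/(2σ²)}`
for all `x > 0`, then for every `s > 0`,
`E[e^{sX}] ≤ 1 + D√(2π)·sσ·e^{s²σ²/2}`, and for every `k > 0`,
`E[e^{sX}] ≤ (1 + D√(k/e)·√(2π))·e^{(1/2 + 1/(2k))s²σ²}`. -/
theorem mgf_bound_of_subGaussian
    {Ω : Type*} [MeasurableSpace Ω] (P : Measure Ω) [IsProbabilityMeasure P]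
    (X : Ω → ℝ) (hX : Measurable X)
    (D σ : ℝ) (hD : 0 < D) (hσ : 0 < σ)
    (htail : ∀ x : ℝ, 0 < x →
      P {ω | x ≤ |X ω|} ≤ ENNReal.ofReal (D * Real.exp (-(x ^ 2) / (2 * σ ^ 2)))) :
    ∀ s : ℝ, 0 < s →
      (∫⁻ ω, ENNReal.ofReal (Real.exp (s * X ω)) ∂P
          ≤ ENNReal.ofReal
              (1 + D * Real.sqrt (2 * Real.pi) * s * σ * Real.exp (s ^ 2 * σ ^ 2 / 2))) ∧
      ∀ k : ℝ, 0 < k →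
        ∫⁻ ω, ENNReal.ofReal (Real.exp (s * X ω)) ∂P
          ≤ ENNReal.ofReal
              ((1 + D * Real.sqrt (k / Real.exp 1) * Real.sqrt (2 * Real.pi))
                * Real.exp ((1 / 2 + 1 / (2 * k)) * s ^ 2 * σ ^ 2)) := by
  intro s hs
  have main : ∫⁻ ω, ENNReal.ofReal (Real.exp (s * X ω)) ∂P
          ≤ ENNReal.ofReal
              (1 + D * Real.sqrt (2 * Real.pi) * s * σ * Real.exp (s ^ 2 * σ ^ 2 / 2)) := by
    have hint : ∀ x : ℝ, ∫ t in (0:ℝ)..x, s * Real.exp (s * t) = Real.exp (s * x) - 1 := by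
      intro x
      have hd : ∀ t ∈ Set.uIcc 0 x,
          HasDerivAt (fun t => Real.exp (s * t)) (s * Real.exp (s * t)) t := by
        intro t _
        have := ((hasDerivAt_id t).const_mul s).exp
        simpa [mul_comm] using this
      rw [intervalIntegral.integral_eq_sub_of_hasDerivAt hd
        (Continuous.intervalIntegrable (by fun_prop) _ _)]
      simp
    have hlc := lintegral_comp_eq_lintegral_meas_le_mul P (f := fun ω => |X ω|)
      (g := fun t => s * Real.exp (s * t)) (Filter.Eventually.of_forall fun ω => abs_nonneg _)
      hX.abs.aemeasurable
      (fun t _ => Continuous.intervalIntegrable (by fun_prop) _ _)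
      (Filter.Eventually.of_forall fun t => by positivity)
    calc ∫⁻ ω, ENNReal.ofReal (Real.exp (s * X ω)) ∂P
        ≤ ∫⁻ ω, (1 + ENNReal.ofReal (∫ t in (0:ℝ)..|X ω|, s * Real.exp (s * t))) ∂P := by
          refine lintegral_mono fun ω => ?_
          have h1 : (1:ℝ) ≤ Real.exp (s * |X ω|) := Real.one_le_exp (by positivity)
          rw [hint, ← ENNReal.ofReal_one, ← ENNReal.ofReal_add zero_le_one (by linarith)]
          refine ENNReal.ofReal_le_ofReal ?_
          rw [add_sub_cancel]
          exact Real.exp_le_exp.2 (mul_le_mul_of_nonneg_left (le_abs_self _) hs.le)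
      _ = 1 + ∫⁻ ω, ENNReal.ofReal (∫ t in (0:ℝ)..|X ω|, s * Real.exp (s * t)) ∂P := by
          rw [lintegral_add_left measurable_const]
          simp
      _ ≤ 1 + ENNReal.ofReal
            (D * Real.sqrt (2 * Real.pi) * s * σ * Real.exp (s ^ 2 * σ ^ 2 / 2)) := by
          rw [hlc, ← aux_int s σ D hs hD hσ]
          refine add_le_add le_rfl ?_
          refine le_trans ?_ (setLIntegral_le_lintegral (Set.Ioi 0) _)
          refine setLIntegral_mono' measurableSet_Ioi fun t ht => ?_
          exact mul_le_mul_left (htail t ht) _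
      _ = _ := by
          rw [ENNReal.ofReal_add zero_le_one (by positivity), ENNReal.ofReal_one]
  refine ⟨main, fun k hk => main.trans (ENNReal.ofReal_le_ofReal ?_)⟩
  have := aux_real (s * σ) k D hD hk
  simpa only [mul_pow, mul_assoc] using this

end TRDT
end
end

section
/- Let X₁, X₂, … be i.i.d. real random variables with cdf F and let F̂_t denote the empirical cdf based on X₁,…,X_t. Then for every n∈ℕ, every x>0, and every k>0: P( max_{1≤t≤n} t·‖F̂_t − F‖_∞ ≥ x ) ≤ (1 + 2√(k/e)·√(2π)) · e^{ −2x²/((1+1/k)·n) }. -/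
open MeasureTheory Set

noncomputable section

namespace TRDT

/-- Kolmogorov (supremum) distance `‖F - G‖_∞`. -/
def supDist (F G : ℝ → ℝ) : ℝ := ⨆ x : ℝ, |F x - G x|

/-- The cdf of a (probability) measure `μ` on `ℝ`. -/
def cdfOf (μ : Measure ℝ) : ℝ → ℝ := fun x => (μ (Set.Iic x)).toReal

/-- The empirical cdf based on the first `t` coordinates of the sample `ω : Fin n → ℝ`. -/
def partialEmpiricalCdf {n : ℕ} (ω : Fin n → ℝ) (t : ℕ) : ℝ → ℝ :=
  fun x => (∑ s ∈ Finset.range t,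
    (if h : s < n then (if ω ⟨s, h⟩ ≤ x then (1 : ℝ) else 0) else 0)) / t


theorem aux_log_pade (q : ℝ) (h0 : 0 ≤ q) (h1 : q < 1) :
    Real.log (1 - q) ≤ -(q * (6 - q) / (6 - 4 * q)) := by
  have key : AntitoneOn (fun q : ℝ => Real.log (1 - q) + q * (6 - q) / (6 - 4 * q)) (Set.Ico 0 1) := by
    have hd : ∀ x ∈ Set.Ico (0:ℝ) 1, HasDerivAt (fun q : ℝ => Real.log (1 - q) + q * (6 - q) / (6 - 4 * q))
        ((-1) / (1 - x) + ((1 * (6 - x) + x * (-1)) * (6 - 4 * x) - x * (6 - x) * (-(4*1))) / (6 - 4 * x)^2) x := by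
      intro x hx
      have h1 : HasDerivAt (fun q : ℝ => 1 - q) (-1) x := by
        simpa using (hasDerivAt_id x).const_sub 1
      have h2 : HasDerivAt (fun q : ℝ => 6 - q) (-1) x := by
        simpa using (hasDerivAt_id x).const_sub 6
      have h3 : HasDerivAt (fun q : ℝ => 6 - 4 * q) (-(4*1)) x := by
        simpa using ((hasDerivAt_id x).const_mul 4).const_sub 6
      exact (h1.log (by linarith [hx.2])).add (((hasDerivAt_id x).mul h2).div h3 (by linarith [hx.2]))
    apply antitoneOn_of_deriv_nonpos (convex_Ico 0 1)
    · intro x hx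
      exact (hd x hx).continuousAt.continuousWithinAt
    · intro x hx
      rw [interior_Ico] at hx
      exact (hd x ⟨hx.1.le, hx.2⟩).differentiableAt.differentiableWithinAt
    · intro x hx
      rw [interior_Ico] at hx
      rw [(hd x ⟨hx.1.le, hx.2⟩).deriv]
      have e1 : (0:ℝ) < 1 - x := by linarith [hx.2]
      have e2 : (0:ℝ) < 6 - 4 * x := by linarith [hx.2]
      rw [div_add_div _ _ e1.ne' (by positivity)]
      apply div_nonpos_of_nonpos_of_nonneg _ (by positivity)
      nlinarith [pow_pos hx.1 3]
  have := key (Set.mem_Ico.2 ⟨le_rfl, one_pos⟩) (Set.mem_Ico.2 ⟨h0, h1⟩) h0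
  simp at this
  linarith

theorem aux_log_ell (e : ℝ) (h0 : 0 ≤ e) :
    -Real.log (1 - 2 * e + 4 / 3 * e ^ 2) ≤ 2 * e + 2 / 3 * e ^ 2 := by
  have hp : ∀ x : ℝ, 0 < 1 - 2 * x + 4 / 3 * x ^ 2 := fun x => by nlinarith [sq_nonneg (x - 3/4)]
  have key : MonotoneOn (fun e : ℝ => Real.log (1 - 2 * e + 4 / 3 * e ^ 2) + (2 * e + 2 / 3 * e ^ 2)) (Set.Ici 0) := by
    have hd : ∀ x : ℝ, HasDerivAt (fun e : ℝ => Real.log (1 - 2 * e + 4 / 3 * e ^ 2) + (2 * e + 2 / 3 * e ^ 2))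
        ((-(2*1) + 4/3 * (2 * x)) / (1 - 2 * x + 4 / 3 * x ^ 2) + (2 * 1 + 2/3 * (2 * x))) x := by
      intro x
      have h1 : HasDerivAt (fun q : ℝ => 1 - 2 * q) (-(2*1)) x := by
        simpa using ((hasDerivAt_id x).const_mul 2).const_sub 1
      have h2 : HasDerivAt (fun q : ℝ => q ^ 2) (2 * x) x := by
        simpa using hasDerivAt_pow 2 x
      exact ((h1.add (h2.const_mul (4/3))).log (hp x).ne').add (((hasDerivAt_id x).const_mul 2).add (h2.const_mul (2/3)))
    apply monotoneOn_of_deriv_nonneg (convex_Ici 0)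
    · intro x hx
      exact (hd x).continuousAt.continuousWithinAt
    · intro x hx
      exact (hd x).differentiableAt.differentiableWithinAt
    · intro x hx
      rw [interior_Ici] at hx
      rw [(hd x).deriv, div_add' _ _ _ (hp x).ne']
      apply div_nonneg _ (hp x).le
      have : (0:ℝ) ≤ x ^ 3 := pow_nonneg (le_of_lt hx) 3
      nlinarith
  have := key (Set.mem_Ici.2 le_rfl) (Set.mem_Ici.2 h0) h0
  simp at this
  linarith

theorem aux_stirling (n j : ℕ) (hj : 1 ≤ j) (hjn : j ≤ n) :
    Real.log (n.factorial) - Real.log (j.factorial) ≤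
      1/2 * Real.log (n / j) + n * Real.log n - n - j * Real.log j + j := by
  obtain ⟨a, rfl⟩ : ∃ a, j = a + 1 := ⟨j - 1, by omega⟩
  obtain ⟨b, rfl⟩ : ∃ b, n = b + 1 := ⟨n - 1, by omega⟩
  have h := Stirling.log_stirlingSeq'_antitone (show a ≤ b by omega)
  simp only [Function.comp, Nat.succ_eq_add_one] at h
  rw [Stirling.log_stirlingSeq_formula, Stirling.log_stirlingSeq_formula] at h
  have ha : (0:ℝ) < ((a+1 : ℕ):ℝ) := by positivity
  have hb : (0:ℝ) < ((b+1 : ℕ):ℝ) := by positivity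
  rw [Real.log_mul two_ne_zero ha.ne', Real.log_mul two_ne_zero hb.ne',
    Real.log_div ha.ne' (Real.exp_pos 1).ne', Real.log_div hb.ne' (Real.exp_pos 1).ne', Real.log_exp] at h
  rw [Real.log_div hb.ne' ha.ne']
  linarith

/-- one-variable bound -/
theorem aux_onevar (Y p : ℝ) (hY : 0.7 ≤ Y) (hp : 0 < p) :
    1/2 * Real.log (2 / p) ≤ Real.log 1.6 + Y * (p + 1/p - 2) := by
  have h1 : 0 ≤ p + 1/p - 2 := by
    have : p + 1/p - 2 = (p-1)^2/p := by field_simp; ring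
    rw [this]; positivity
  have h2 : 0.7 * (p + 1/p - 2) ≤ Y * (p + 1/p - 2) := mul_le_mul_of_nonneg_right hY h1
  -- log (2/p) = log (1/(1.39 p)) + log 1.39 + log 2
  have h3 : Real.log (2/p) = Real.log (1/(1.39*p)) + Real.log (2 * 1.39) := by
    rw [← Real.log_mul (by positivity) (by norm_num)]; congr 1; field_simp
  have h4 : Real.log (1/(1.39*p)) ≤ 1/(1.39*p) - 1 := Real.log_le_sub_one_of_pos (by positivity)
  have h5 : Real.log (2*1.39) - 2 * Real.log 1.6 ≤ 0.0861 := by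
    have : Real.log (2*1.39) - 2 * Real.log 1.6 = Real.log (2*1.39/1.6^2) := by
      rw [Real.log_div (by norm_num) (by norm_num), Real.log_pow]; norm_num
    rw [this]
    have := Real.log_le_sub_one_of_pos (show (0:ℝ) < 2*1.39/1.6^2 by norm_num)
    norm_num at this ⊢
    linarith
  have h6 : 1/(1.39*p) ≤ 0.7195 * (1/p) := by
    rw [one_div, mul_inv, one_div]; gcongr; norm_num
  -- need 0.5*(0.7195 v - 1 + 0.0861) ≤ 0.7 (p+v-2)
  have h7 : 0 ≤ 0.7 * (p + 1/p - 2) - 0.5*(0.7195 * (1/p) - 1 + 0.0861) := by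
    have : 0.7 * (p + 1/p - 2) - 0.5*(0.7195 * (1/p) - 1 + 0.0861) = (0.7 * p^2 - 0.94305*p + 0.34025)/p := by
      field_simp; ring
    rw [this]
    apply div_nonneg _ hp.le
    nlinarith [sq_nonneg (p - 0.6736)]
  rw [h3]
  linarith

theorem aux_R (n : ℕ) (u : ℝ) (hu : 0 < u) (hun : u < n) (hY : 0.7 ≤ u^2/n) :
    ∃ lam : ℝ, 0 < lam ∧ ∀ j : ℕ, j ≤ n → ∀ F : ℝ, 0 ≤ F → F ≤ 1 → n * F + u ≤ j →
      F ^ j ≤ (1.6 * Real.exp (-(2*u^2/n))) *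
        (lam ^ (n - j) * Real.exp (-(lam * (1 - F))) * (j.factorial / n.factorial)) := by
  have hn : (0:ℝ) < n := hu.trans hun
  set e : ℝ := u / n with he
  have he0 : 0 < e := by positivity
  have he1 : e < 1 := by rw [he, div_lt_one hn]; exact hun
  set l : ℝ := 1 - 2 * e + 4 / 3 * e ^ 2 with hl
  have hl0 : 0 < l := by nlinarith [sq_nonneg (e - 3/4)]
  have hl1 : l ≤ 1 := by nlinarith
  refine ⟨n * l, by positivity, ?_⟩
  intro j hjn F hF0 hF1 hj
  have hjpos : 0 < j := by
    have : (0:ℝ) < j := by nlinarith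
    exact_mod_cast this
  have hju : u ≤ j := by nlinarith
  rcases hF0.eq_or_lt with h | hF
  · rw [← h, zero_pow hjpos.ne']; positivity
  have hjr : (0:ℝ) < j := by exact_mod_cast hjpos
  have hju' : u < j := by nlinarith
  have hjn' : (j:ℝ) ≤ n := by exact_mod_cast hjn
  have hfac1 : (0:ℝ) < j.factorial := by exact_mod_cast Nat.factorial_pos j
  have hfac2 : (0:ℝ) < n.factorial := by exact_mod_cast Nat.factorial_pos n
  rw [← Real.log_le_log_iff (by positivity) (by positivity)]
  rw [Real.log_pow, Real.log_mul (by positivity) (by positivity), Real.log_mul (by positivity) (by positivity),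
    Real.log_mul (by positivity) (by positivity), Real.log_mul (by positivity) (by positivity),
    Real.log_div (by positivity) (by positivity), Real.log_exp, Real.log_exp, Real.log_pow,
    Real.log_mul hn.ne' hl0.ne', Nat.cast_sub hjn]
  have hst := aux_stirling n j hjpos hjn
  set F0 : ℝ := (j - u) / n with hF0def
  have hF0p : 0 < F0 := by apply div_pos; linarith; exact hn
  have hFF0 : F ≤ F0 := by rw [hF0def, le_div_iff₀ hn]; linarith
  -- monotone in F
  have hmono : j * Real.log F + n * l * (1 - F) ≤ j * Real.log F0 + n * l * (1 - F0) := by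
    have h1 : Real.log F - Real.log F0 ≤ F / F0 - 1 := by
      rw [← Real.log_div hF.ne' hF0p.ne']; exact Real.log_le_sub_one_of_pos (by positivity)
    have h2 : n * l * F0 ≤ j := by
      have : n * F0 = j - u := by rw [hF0def]; field_simp
      nlinarith
    have h3 : j * (F / F0 - 1) ≤ n * l * (F - F0) := by
      have : F / F0 - 1 = -((F0 - F)/F0) := by field_simp; ring
      rw [this]
      have h4 : n * l ≤ j / F0 := by rw [le_div_iff₀ hF0p]; exact h2
      have h5 : j * ((F0 - F)/F0) = j / F0 * (F0 - F) := by field_simp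
      nlinarith
    nlinarith
  have hlogF0 : Real.log F0 = Real.log (1 - u / j) + Real.log j - Real.log n := by
    rw [← Real.log_mul, ← Real.log_div]
    · congr 1; rw [hF0def]; field_simp
    · have : u / j < 1 := by rw [div_lt_one hjr]; exact hju'
      have : 0 < 1 - u / j := by linarith
      positivity
    · positivity
    · have : u / j < 1 := by rw [div_lt_one hjr]; exact hju'
      linarith
    · positivity
  have hq := aux_log_pade (u / j) (by positivity) (by rw [div_lt_one hjr]; exact hju')
  have hlog := aux_log_ell e he0.le
  rw [← hl] at hlog
  set p : ℝ := (6 * j - 4 * u) / (3 * n) with hp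
  have hp0 : 0 < p := by apply div_pos; linarith; positivity
  have hone := aux_onevar (u^2/n) p hY hp0
  have hsig : 1/2 * Real.log (n / j) ≤ 1/2 * Real.log (2 / p) := by
    apply mul_le_mul_of_nonneg_left _ (by norm_num)
    apply Real.log_le_log (by positivity)
    rw [div_le_div_iff₀ hjr hp0, hp]
    have : (n:ℝ) * ((6 * j - 4 * u) / (3 * n)) = (6*j - 4*u)/3 := by field_simp
    rw [this]; linarith
  have hq' : j * Real.log (1 - u/j) ≤ -u - u^2/n * (1/p) := by
    have h1 : j * Real.log (1 - u/j) ≤ j * (-(u / j * (6 - u / j) / (6 - 4 * (u / j)))) :=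
      mul_le_mul_of_nonneg_left hq hjr.le
    have h2 : j * (-(u / j * (6 - u / j) / (6 - 4 * (u / j)))) = -u - u^2/n * (1/p) := by
      have h3 : (3 * (j:ℝ) - 2 * u) ≠ 0 := by linarith
      have h3' : (6 * (j:ℝ) - 4 * u) = 2 * (3 * j - 2 * u) := by ring
      have h4 : 6 - 4 * (u / j) = (6 * j - 4 * u)/j := by field_simp
      rw [h4, hp, h3']
      generalize hD : 3 * (j:ℝ) - 2 * u = D at h3 ⊢
      field_simp
      rw [← hD]
      ring
    linarith
  have hlog' : (n - j) * (-Real.log l) ≤ (n - j) * (2 * e + 2/3 * e^2) :=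
    mul_le_mul_of_nonneg_left hlog (by linarith)
  have hnF0 : n * l * (1 - F0) = l * (n - j + u) := by rw [hF0def]; field_simp; ring
  have hiden : (n - j) * (2 * e + 2/3 * e^2) + l * (n - j + u) - (n - j) - u = - (u^2/n * p) := by
    rw [hl, hp, he]; field_simp; ring
  rw [hnF0, hlogF0] at hmono
  have e1 : 2 * u^2/n = 2 * (u^2/n) := by ring
  rw [e1]
  have e2 : u ^ 2 / n * (p + 1 / p - 2) = u^2/n*p + u^2/n*(1/p) - 2 * (u^2/n) := by ring
  rw [e2] at hone
  clear_value p F0 l e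
  linarith



theorem scan_sum (n m : ℕ) (hm : m ≤ n) (lam a D : ℝ) (hlam : 0 < lam) (hD : 0 ≤ D) :
    ∑ i ∈ Finset.range (m + 1), (m.choose i : ℝ) * (D ^ (m - i) *
      (lam ^ (n - i) * Real.exp (-(lam * (a + D))) * (i.factorial / n.factorial)))
    ≤ lam ^ (n - m) * Real.exp (-(lam * a)) * (m.factorial / n.factorial) := by
  have h1 : ∀ i ∈ Finset.range (m+1), (m.choose i : ℝ) * (D ^ (m - i) *
      (lam ^ (n - i) * Real.exp (-(lam * (a + D))) * (i.factorial / n.factorial)))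
      = (lam ^ (n - m) * Real.exp (-(lam * (a + D))) * (m.factorial / n.factorial)) *
        ((lam * D) ^ (m - i) / (m - i).factorial) := by
    intro i hi
    have him : i ≤ m := by simpa [Nat.lt_succ_iff] using hi
    have hc : (m.choose i : ℝ) * i.factorial * (m - i).factorial = m.factorial := by
      exact_mod_cast Nat.choose_mul_factorial_mul_factorial him
    have hl : lam ^ (n - i) = lam ^ (n - m) * lam ^ (m - i) := by
      rw [← pow_add]; congr 1; omega
    rw [hl, ← hc, mul_pow]
    have := Nat.factorial_pos (m - i)
    field_simp
  rw [Finset.sum_congr rfl h1, ← Finset.mul_sum]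
  have h2 : ∑ i ∈ Finset.range (m+1), ((lam * D) ^ (m - i) / ((m - i).factorial : ℝ)) ≤ Real.exp (lam * D) := by
    have := Finset.sum_range_reflect (fun i => (lam * D) ^ i / (i.factorial : ℝ)) (m+1)
    simp only [Nat.add_sub_cancel] at this
    rw [this]
    exact Real.sum_le_exp_of_nonneg (by positivity) _
  calc _ ≤ (lam ^ (n - m) * Real.exp (-(lam * (a + D))) * (m.factorial / n.factorial)) * Real.exp (lam * D) := by
        gcongr
    _ = _ := by
        have : Real.exp (-(lam * a)) = Real.exp (-(lam * (a + D))) * Real.exp (lam * D) := by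
          rw [← Real.exp_add]; congr 1; ring
        rw [this]; ring

theorem scan_main {α : Type*} [MeasurableSpace α] (μ : Measure α) [IsProbabilityMeasure μ]
    (n : ℕ) (lam u K : ℝ) (hlam : 0 < lam) (hK : 0 ≤ K)
    (hyp : ∀ j : ℕ, j ≤ n → ∀ F : ℝ, 0 ≤ F → F ≤ 1 → n * F + u ≤ j →
      F ^ j ≤ K * (lam ^ (n - j) * Real.exp (-(lam * (1 - F))) * (j.factorial / n.factorial)))
    (l : List (Set α)) :
    (∀ E ∈ l, MeasurableSet E) → l.Pairwise (· ⊆ ·) → ∀ E0 : Set α, MeasurableSet E0 →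
    (∀ E ∈ l, E0 ⊆ E) → ∀ (ι : Type) [Fintype ι], Fintype.card ι ≤ n →
    (Measure.pi fun _ : ι => μ).real {ω | (∀ s, ω s ∉ E0) ∧ ∃ E ∈ l,
        n * μ.real Eᶜ + u ≤ ∑ s, Eᶜ.indicator (fun _ => (1:ℝ)) (ω s)}
      ≤ K * (lam ^ (n - Fintype.card ι) * Real.exp (-(lam * μ.real E0)) *
          ((Fintype.card ι).factorial / n.factorial)) := by
  classical
  induction l with
  | nil =>
    intro _ _ E0 _ _ ι _ _
    simp
    positivity
  | cons E l ih =>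
    intro hmeas hpw E0 hE0 hsub ι _ hcard
    rw [List.pairwise_cons] at hpw
    have hE : MeasurableSet E := hmeas E (by simp)
    have hE0E : E0 ⊆ E := hsub E (by simp)
    set A : Set (ι → α) := {ω | (∀ s, ω s ∉ E0) ∧ ∃ E' ∈ E :: l,
        n * μ.real E'ᶜ + u ≤ ∑ s, E'ᶜ.indicator (fun _ => (1:ℝ)) (ω s)} with hA
    set H : ℕ → ℝ := fun i => lam ^ (n - i) * Real.exp (-(lam * μ.real E)) *
          ((i.factorial : ℝ) / n.factorial) with hH
    have hcE : μ.real Eᶜ = 1 - μ.real E := by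
      rw [measureReal_compl hE]; simp
    have hS : ∀ S : Finset ι, (Measure.pi fun _ : ι => μ).real (A ∩ {ω | ∀ s, s ∈ S ↔ ω s ∉ E})
        ≤ K * (μ.real (E \ E0) ^ (Fintype.card ι - S.card) * H S.card) := by
      intro S
      obtain ⟨p, hp⟩ : ∃ p : ι → Prop, ∀ s, p s ↔ s ∈ S := ⟨_, fun _ => Iff.rfl⟩
      have hcardS : Fintype.card {s // p s} = S.card := Fintype.card_of_subtype S (fun s => (hp s).symm)
      let e := MeasurableEquiv.piEquivPiSubtypeProd (fun _ : ι => α) p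
      let B : Set ({s // p s} → α) := {ω | (∀ s, ω s ∉ E) ∧ ((n * μ.real Eᶜ + u ≤ S.card) ∨
        ∃ E' ∈ l, n * μ.real E'ᶜ + u ≤ ∑ s, E'ᶜ.indicator (fun _ => (1:ℝ)) (ω s))}
      let C : Set ({s // ¬ p s} → α) := Set.univ.pi fun _ => E \ E0
      have hsubset : A ∩ {ω | ∀ s, s ∈ S ↔ ω s ∉ E} ⊆ e ⁻¹' (B ×ˢ C) := by
        rintro ω ⟨⟨h0, E', hE'l, hE'⟩, hωS⟩
        simp only [Set.mem_ofPred_eq] at hωS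
        have hsum : ∀ E'' : Set α, E ⊆ E'' → ∑ s, E''ᶜ.indicator (fun _ => (1:ℝ)) (ω s)
            = ∑ s : {s // p s}, E''ᶜ.indicator (fun _ => (1:ℝ)) (ω s) := by
          intro E'' hEE
          rw [← Fintype.sum_subtype_add_sum_subtype p]
          rw [add_eq_left]
          apply Finset.sum_eq_zero
          rintro ⟨s, hs⟩ _
          have : ω s ∈ E := by
            by_contra h
            exact hs ((hp s).2 ((hωS s).2 h))
          simp [hEE this]
        refine ⟨⟨fun s => (hωS s).1 ((hp s).1 s.2), ?_⟩, ?_⟩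
        · rcases List.mem_cons.1 hE'l with rfl | hE'l
          · left
            rw [hsum _ subset_rfl] at hE'
            refine hE'.trans ?_
            calc _ ≤ ∑ s : {s // p s}, (1:ℝ) :=
                  Finset.sum_le_sum fun s _ => Set.indicator_le_self' (fun _ _ => zero_le_one) _
              _ = _ := by simp [hcardS]
          · right
            refine ⟨E', hE'l, ?_⟩
            rw [hsum _ (hpw.1 E' hE'l)] at hE'
            exact hE'
        · rintro ⟨s, hs⟩ _
          refine ⟨?_, h0 s⟩
          by_contra h
          exact hs ((hp s).2 ((hωS s).2 h))
      have hScard : S.card ≤ Fintype.card ι := Finset.card_le_univ S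
      have hB : (Measure.pi fun _ : {s // p s} => μ).real B ≤ K * H S.card := by
        by_cases hhit : n * μ.real Eᶜ + u ≤ S.card
        · have : B ⊆ Set.univ.pi fun _ => Eᶜ := fun ω hω s _ => hω.1 s
          calc _ ≤ (Measure.pi fun _ : {s // p s} => μ).real (Set.univ.pi fun _ => Eᶜ) :=
                measureReal_mono this
            _ = μ.real Eᶜ ^ S.card := by
                rw [measureReal_def, Measure.pi_pi]; simp [measureReal_def, hcardS]
            _ ≤ _ := by
                have := hyp S.card (hScard.trans hcard) (μ.real Eᶜ) measureReal_nonneg measureReal_le_one hhit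
                rwa [hcE, show 1 - (1 - μ.real E) = μ.real E by ring, ← hcE] at this
        · have := ih (fun E' h => hmeas E' (by simp [h])) hpw.2 E hE hpw.1 {s // p s} (by rw [hcardS]; omega)
          rw [hcardS] at this
          refine le_trans (measureReal_mono ?_) this
          rintro ω ⟨h1, h2⟩
          exact ⟨h1, h2.resolve_left hhit⟩
      have hC : (Measure.pi fun _ : {s // ¬ p s} => μ).real C = μ.real (E \ E0) ^ (Fintype.card ι - S.card) := by
        rw [measureReal_def, Measure.pi_pi]
        simp [measureReal_def, Fintype.card_subtype_compl, hcardS]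
      calc _ ≤ (Measure.pi fun _ : ι => μ).real (e ⁻¹' (B ×ˢ C)) := measureReal_mono hsubset
        _ = (Measure.pi fun _ : {s // p s} => μ).real B * (Measure.pi fun _ : {s // ¬ p s} => μ).real C := by
            rw [measureReal_def, (measurePreserving_piEquivPiSubtypeProd (fun _ : ι => μ) p).measure_preimage_equiv,
              Measure.prod_prod, ENNReal.toReal_mul]
            rfl
        _ ≤ (K * H S.card) * μ.real (E \ E0) ^ (Fintype.card ι - S.card) := by
            rw [hC]; gcongr
        _ = _ := by ring
    have hcov : A ⊆ ⋃ S ∈ (Finset.univ : Finset ι).powerset, (A ∩ {ω | ∀ s, s ∈ S ↔ ω s ∉ E}) := by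
      intro ω hω
      simp only [Set.mem_iUnion]
      refine ⟨Finset.univ.filter (fun s => ω s ∉ E), by simp, hω, by simp⟩
    have hD : μ.real E = μ.real E0 + μ.real (E \ E0) := by
      rw [measureReal_sdiff hE0E hE0]; ring
    calc _ ≤ (Measure.pi fun _ : ι => μ).real (⋃ S ∈ (Finset.univ : Finset ι).powerset, (A ∩ {ω | ∀ s, s ∈ S ↔ ω s ∉ E})) :=
          measureReal_mono hcov (measure_ne_top _ _)
      _ ≤ ∑ S ∈ (Finset.univ : Finset ι).powerset, (Measure.pi fun _ : ι => μ).real (A ∩ {ω | ∀ s, s ∈ S ↔ ω s ∉ E}) :=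
          measureReal_biUnion_finset_le _ _
      _ ≤ ∑ S ∈ (Finset.univ : Finset ι).powerset, K * (μ.real (E \ E0) ^ (Fintype.card ι - S.card) * H S.card) :=
          Finset.sum_le_sum fun S _ => hS S
      _ = K * ∑ i ∈ Finset.range (Fintype.card ι + 1), ((Fintype.card ι).choose i : ℝ) *
            (μ.real (E \ E0) ^ (Fintype.card ι - i) * H i) := by
          rw [← Finset.mul_sum, Finset.sum_powerset_apply_card (fun i => μ.real (E \ E0) ^ (Fintype.card ι - i) * H i)]
          simp [nsmul_eq_mul]
      _ ≤ _ := by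
          apply mul_le_mul_of_nonneg_left _ hK
          have := scan_sum n (Fintype.card ι) hcard lam (μ.real E0) (μ.real (E \ E0)) hlam measureReal_nonneg
          rw [← hD] at this
          exact this


theorem tail_chain (μ : Measure ℝ) [IsProbabilityMeasure μ] (n : ℕ) (u : ℝ) (hu : 0 < u)
    (hun : u < n) (hY : 0.7 ≤ u ^ 2 / n) (E : ℚ → Set ℝ) (hE : Monotone E)
    (hEm : ∀ q, MeasurableSet (E q)) :
    (Measure.pi fun _ : Fin n => μ) {ω | ∃ q, n * μ.real (E q)ᶜ + u ≤
        ∑ s, (E q)ᶜ.indicator (fun _ => (1:ℝ)) (ω s)}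
      ≤ ENNReal.ofReal (1.6 * Real.exp (-(2 * u ^ 2 / n))) := by
  obtain ⟨lam, hlam, hyp⟩ := aux_R n u hu hun hY
  let A : Finset ℚ → Set (Fin n → ℝ) := fun T => {ω | ∃ q ∈ T, n * μ.real (E q)ᶜ + u ≤
        ∑ s, (E q)ᶜ.indicator (fun _ => (1:ℝ)) (ω s)}
  have hA : {ω : Fin n → ℝ | ∃ q, n * μ.real (E q)ᶜ + u ≤
        ∑ s, (E q)ᶜ.indicator (fun _ => (1:ℝ)) (ω s)} = ⋃ T, A T := by
    ext ω
    simp only [Set.mem_ofPred_eq, Set.mem_iUnion, A]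
    constructor
    · rintro ⟨q, hq⟩
      exact ⟨{q}, q, by simp, hq⟩
    · rintro ⟨T, q, _, hq⟩
      exact ⟨q, hq⟩
  have hmono : Monotone A := by
    rintro T T' hTT ω ⟨q, hq, h⟩
    exact ⟨q, hTT hq, h⟩
  rw [hA, hmono.directed_le.measure_iUnion]
  refine iSup_le fun T => ?_
  have h := scan_main μ n lam u (1.6 * Real.exp (-(2 * u ^ 2 / n))) hlam (by positivity) hyp
    ((T.sort (· ≤ ·)).map E) (by
      intro E' h'
      obtain ⟨q, _, rfl⟩ := List.mem_map.1 h'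
      exact hEm q) (by
      rw [List.pairwise_map]
      exact (Finset.pairwise_sort T (· ≤ ·)).imp fun h => hE h) ∅ MeasurableSet.empty (by simp)
      (Fin n) (by simp)
  have hn : (n.factorial : ℝ) ≠ 0 := by positivity
  simp only [Fintype.card_fin, Nat.sub_self, pow_zero, measureReal_empty, mul_zero, neg_zero,
    Real.exp_zero, div_self hn, mul_one] at h
  refine (ENNReal.le_ofReal_iff_toReal_le (measure_ne_top _ _) (by positivity)).2 ?_
  refine le_trans (measureReal_mono ?_) h
  rintro ω ⟨q, hq, h⟩
  exact ⟨by simp, E q, List.mem_map.2 ⟨q, by simpa using hq, rfl⟩, h⟩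

def dev (μ : Measure ℝ) {n : ℕ} (m : ℕ) (z : ℝ) (ω : Fin n → ℝ) : ℝ :=
  ∑ s : Fin n, if (s : ℕ) < m then ((Iic z).indicator (fun _ => (1:ℝ)) (ω s) - cdfOf μ z) else 0

def Ysup (μ : Measure ℝ) {n : ℕ} (m : ℕ) (ω : Fin n → ℝ) : ℝ := ⨆ z : ℝ, |dev μ m z ω|

theorem cdfOf_mem (μ : Measure ℝ) [IsProbabilityMeasure μ] (z : ℝ) :
    0 ≤ cdfOf μ z ∧ cdfOf μ z ≤ 1 :=
  ⟨ENNReal.toReal_nonneg, measureReal_le_one (μ := μ) (s := Iic z)⟩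

theorem dev_abs_le (μ : Measure ℝ) [IsProbabilityMeasure μ] {n : ℕ} (m : ℕ) (z : ℝ)
    (ω : Fin n → ℝ) : |dev μ m z ω| ≤ n := by
  unfold dev
  refine (Finset.abs_sum_le_sum_abs _ _).trans ?_
  calc _ ≤ ∑ s : Fin n, (1:ℝ) := by
        refine Finset.sum_le_sum fun s _ => ?_
        have := cdfOf_mem μ z
        split_ifs
        · by_cases h : ω s ∈ Iic z
          · rw [indicator_of_mem h, abs_le]; constructor <;> linarith
          · rw [indicator_of_notMem h, abs_le]; constructor <;> linarith
        · simp
    _ = n := by simp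

theorem Ysup_bdd (μ : Measure ℝ) [IsProbabilityMeasure μ] {n : ℕ} (m : ℕ) (ω : Fin n → ℝ) :
    BddAbove (range fun z : ℝ => |dev μ m z ω|) :=
  ⟨n, by rintro _ ⟨z, rfl⟩; exact dev_abs_le μ m z ω⟩

theorem dev_le_Ysup (μ : Measure ℝ) [IsProbabilityMeasure μ] {n : ℕ} (m : ℕ) (z : ℝ)
    (ω : Fin n → ℝ) : |dev μ m z ω| ≤ Ysup μ m ω :=
  le_ciSup (Ysup_bdd μ m ω) z

theorem mul_supDist (μ : Measure ℝ) {n : ℕ} (m : ℕ) (hm : 1 ≤ m) (hmn : m ≤ n) (ω : Fin n → ℝ) :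
    m * supDist (partialEmpiricalCdf ω m) (cdfOf μ) = Ysup μ m ω := by
  unfold supDist Ysup
  rw [Real.mul_iSup_of_nonneg (by positivity)]
  congr 1
  ext z
  have hm0 : (0:ℝ) < m := by exact_mod_cast hm
  rw [show (m:ℝ) * |partialEmpiricalCdf ω m z - cdfOf μ z| = |m * (partialEmpiricalCdf ω m z - cdfOf μ z)| by
    rw [abs_mul, abs_of_pos hm0]]
  congr 1
  unfold partialEmpiricalCdf dev
  have h1 : ∀ s : Fin n, (if (s : ℕ) < m then ((Iic z).indicator (fun _ => (1:ℝ)) (ω s) - cdfOf μ z) else 0)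
    = (fun i : ℕ => if i < m then ((if h : i < n then (if ω ⟨i, h⟩ ≤ z then (1 : ℝ) else 0) else 0) - cdfOf μ z) else 0) s := by
    intro s
    simp [Set.indicator_apply]
  rw [Finset.sum_congr rfl (fun s _ => h1 s), Fin.sum_univ_eq_sum_range (fun i : ℕ => if i < m then ((if h : i < n then (if ω ⟨i, h⟩ ≤ z then (1 : ℝ) else 0) else 0) - cdfOf μ z) else 0) n, ← Finset.sum_filter]
  have h2 : (Finset.range n).filter (· < m) = Finset.range m := by
    ext i; simp; omega
  rw [h2, Finset.sum_sub_distrib]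
  generalize (∑ s ∈ Finset.range m, (if h : s < n then (if ω ⟨s, h⟩ ≤ z then (1 : ℝ) else 0) else 0)) = S
  simp only [Finset.sum_const, Finset.card_range, nsmul_eq_mul]
  field_simp

theorem lt_Ysup (μ : Measure ℝ) [IsProbabilityMeasure μ] {n : ℕ} (m : ℕ) (ω : Fin n → ℝ) (a : ℝ) :
    a < Ysup μ m ω ↔ ∃ q : ℚ, a < |dev μ m q ω| := by
  constructor
  · intro h
    obtain ⟨z, hz⟩ := exists_lt_of_lt_ciSup h
    have hc : Filter.Tendsto (fun z' => |dev μ m z' ω|) (nhdsWithin z (Ioi z)) (nhds |dev μ m z ω|) := by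
      apply Filter.Tendsto.abs
      unfold dev
      refine tendsto_finsetSum _ fun s _ => ?_
      split_ifs
      · refine Filter.Tendsto.sub ?_ ?_
        · by_cases hs : ω s ≤ z
          · refine tendsto_const_nhds.congr' ?_
            filter_upwards [self_mem_nhdsWithin] with z' hz'
            rw [indicator_of_mem (show ω s ∈ Iic z from hs), indicator_of_mem (show ω s ∈ Iic z' from hs.trans (le_of_lt hz'))]
          · refine tendsto_const_nhds.congr' ?_
            push Not at hs
            filter_upwards [Ioo_mem_nhdsGT hs] with z' hz'
            rw [indicator_of_notMem (show ω s ∉ Iic z from not_le.2 hs), indicator_of_notMem (show ω s ∉ Iic z' from not_le.2 hz'.2)]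
        · have : cdfOf μ = ProbabilityTheory.cdf μ := by
            ext w; rw [ProbabilityTheory.cdf_eq_real]; rfl
          rw [this]
          exact ((ProbabilityTheory.cdf μ).right_continuous z).mono_left (nhdsWithin_mono _ Ioi_subset_Ici_self)
      · exact tendsto_const_nhds
    have hev := hc.eventually (lt_mem_nhds hz)
    obtain ⟨b, hb, hbs⟩ := (mem_nhdsGT_iff_exists_Ioo_subset).1 hev
    obtain ⟨q, hq1, hq2⟩ := exists_rat_btwn (show z < b from hb)
    exact ⟨q, hbs ⟨hq1, hq2⟩⟩
  · rintro ⟨q, hq⟩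
    exact hq.trans_le (dev_le_Ysup μ m q ω)

theorem dev_meas (μ : Measure ℝ) {n : ℕ} (m : ℕ) (z : ℝ) :
    Measurable (fun ω : Fin n → ℝ => dev μ m z ω) := by
  unfold dev
  refine Finset.measurable_sum _ fun s _ => ?_
  split_ifs
  · refine Measurable.sub ?_ measurable_const
    exact (measurable_const.indicator measurableSet_Iic).comp (measurable_pi_apply s)
  · exact measurable_const

theorem Ysup_meas (μ : Measure ℝ) [IsProbabilityMeasure μ] {n : ℕ} (m : ℕ) :
    Measurable (fun ω : Fin n → ℝ => Ysup μ m ω) := by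
  refine measurable_of_Ioi fun a => ?_
  have : (fun ω : Fin n → ℝ => Ysup μ m ω) ⁻¹' Ioi a = ⋃ q : ℚ, {ω | a < |dev μ m q ω|} := by
    ext ω
    simp [lt_Ysup]
  rw [this]
  exact MeasurableSet.iUnion fun q => measurableSet_lt measurable_const (dev_meas μ m q).abs

theorem tail_bound (μ : Measure ℝ) [IsProbabilityMeasure μ] (n : ℕ) (u : ℝ) (hu : 0 < u)
    (hY : 0.7 ≤ u ^ 2 / n) :
    (Measure.pi fun _ : Fin n => μ) {ω | u < Ysup μ n ω}
      ≤ ENNReal.ofReal (3.2 * Real.exp (-(2 * u ^ 2 / n))) := by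
  by_cases hun : u < n
  swap
  · have : {ω : Fin n → ℝ | u < Ysup μ n ω} = ∅ := by
      ext ω
      simp only [Set.mem_ofPred_eq, mem_empty_iff_false, iff_false, lt_Ysup]
      rintro ⟨q, hq⟩
      have := dev_abs_le μ n q ω
      linarith
    rw [this]; simp
  have hp := tail_chain μ n u hu hun hY (fun q => Ioi (-(q:ℝ)))
    (fun a b h => Ioi_subset_Ioi (by simpa using h)) (fun _ => measurableSet_Ioi)
  have hm := tail_chain μ n u hu hun hY (fun q => Iic (q:ℝ))
    (fun a b h => Iic_subset_Iic.2 (by simpa using h)) (fun _ => measurableSet_Iic)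
  rw [show 3.2 * Real.exp (-(2 * u ^ 2 / n)) = 1.6 * Real.exp (-(2 * u ^ 2 / n)) + 1.6 * Real.exp (-(2 * u ^ 2 / n)) by ring,
    ENNReal.ofReal_add (by positivity) (by positivity)]
  refine le_trans (le_trans (measure_mono ?_) (measure_union_le _ _)) (add_le_add hp hm)
  intro ω hω
  obtain ⟨q, hq⟩ := (lt_Ysup μ n ω u).1 hω
  have hdev : dev μ n q ω = ∑ s, (Iic (q:ℝ)).indicator (fun _ => (1:ℝ)) (ω s) - n * μ.real (Iic (q:ℝ)) := by
    unfold dev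
    simp [Finset.sum_sub_distrib]
    left
    rfl
  rcases lt_abs.1 hq with h | h
  · left
    refine ⟨-q, ?_⟩
    simp only [Rat.cast_neg, neg_neg, compl_Ioi]
    linarith
  · right
    refine ⟨q, ?_⟩
    have h1 : ∀ s, (Iic (q:ℝ))ᶜ.indicator (fun _ => (1:ℝ)) (ω s) = 1 - (Iic (q:ℝ)).indicator (fun _ => (1:ℝ)) (ω s) := by
      intro s
      by_cases hs : ω s ≤ q
      · simp [Set.indicator_apply, hs]
      · simp [Set.indicator_apply, hs, not_le.1 hs]
    rw [Finset.sum_congr rfl fun s _ => h1 s, Finset.sum_sub_distrib, measureReal_compl measurableSet_Iic]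
    simp
    linarith


theorem dev_congr (μ : Measure ℝ) {n : ℕ} (m : ℕ) (z : ℝ) (ω ω' : Fin n → ℝ)
    (h : ∀ s : Fin n, (s : ℕ) < m → ω s = ω' s) : dev μ m z ω = dev μ m z ω' := by
  unfold dev
  refine Finset.sum_congr rfl fun s _ => ?_
  split_ifs with hs
  · rw [h s hs]
  · rfl

theorem Ysup_congr (μ : Measure ℝ) {n : ℕ} (m : ℕ) (ω ω' : Fin n → ℝ)
    (h : ∀ s : Fin n, (s : ℕ) < m → ω s = ω' s) : Ysup μ m ω = Ysup μ m ω' := by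
  unfold Ysup
  congr 1
  ext z
  rw [dev_congr μ m z ω ω' h]

theorem ofReal_integral_le {β : Type*} [MeasurableSpace β] (ν : Measure β) (f : β → ℝ)
    (hf : Integrable f ν) : ENNReal.ofReal (∫ b, f b ∂ν) ≤ ∫⁻ b, ENNReal.ofReal (f b) ∂ν := by
  rw [integral_eq_lintegral_pos_part_sub_lintegral_neg_part hf]
  refine (ENNReal.ofReal_le_ofReal (sub_le_self _ ENNReal.toReal_nonneg)).trans ?_
  exact ENNReal.ofReal_toReal_le

theorem doob_step (μ : Measure ℝ) [IsProbabilityMeasure μ] (n m : ℕ) (hm : m ≤ n)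
    (B : Set (Fin n → ℝ)) (hB : MeasurableSet B)
    (hdep : ∀ ω ω' : Fin n → ℝ, (∀ s : Fin n, (s : ℕ) < m → ω s = ω' s) → (ω ∈ B → ω' ∈ B))
    (x v : ℝ) (hBx : ∀ ω ∈ B, x ≤ Ysup μ m ω) :
    ENNReal.ofReal (x - v) * (Measure.pi fun _ : Fin n => μ) B
      ≤ ∫⁻ ω in B, ENNReal.ofReal (Ysup μ n ω - v) ∂(Measure.pi fun _ : Fin n => μ) := by
  have hmp := (measurePreserving_piEquivPiSubtypeProd (fun _ : Fin n => μ) (fun s => (s:ℕ) < m)).symm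
  set e := MeasurableEquiv.piEquivPiSubtypeProd (fun _ : Fin n => ℝ) (fun s => (s:ℕ) < m) with he
  have hes : ∀ a b s, e.symm (a, b) s = if h : (s:ℕ) < m then a ⟨s, h⟩ else b ⟨s, h⟩ := fun _ _ _ => rfl
  have hYm : Measurable fun ω : Fin n → ℝ => ENNReal.ofReal (Ysup μ n ω - v) :=
    ((Ysup_meas μ n).sub_const v).ennreal_ofReal
  rw [← setLIntegral_const, ← lintegral_indicator hB, ← lintegral_indicator hB]
  have hm1 : Measurable (B.indicator fun _ => ENNReal.ofReal (x - v)) := measurable_const.indicator hB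
  have hm2 := hYm.indicator hB
  rw [← hmp.lintegral_comp hm1, ← hmp.lintegral_comp hm2,
    lintegral_prod (fun ab => B.indicator (fun _ => ENNReal.ofReal (x - v)) (e.symm ab)) (hm1.comp e.symm.measurable).aemeasurable,
    lintegral_prod (fun ab => B.indicator (fun ω => ENNReal.ofReal (Ysup μ n ω - v)) (e.symm ab)) (hm2.comp e.symm.measurable).aemeasurable]
  refine lintegral_mono fun a => ?_
  have hagree : ∀ b b', ∀ s : Fin n, (s:ℕ) < m → e.symm (a, b) s = e.symm (a, b') s := by
    intro b b' s hs
    rw [hes, hes, dif_pos hs, dif_pos hs]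
  let b0 : {s : Fin n // ¬ (s:ℕ) < m} → ℝ := fun _ => 0
  by_cases h0 : e.symm (a, b0) ∈ B
  swap
  · refine lintegral_mono fun b => ?_
    have : e.symm (a, b) ∉ B := fun h => h0 (hdep _ _ (hagree b b0) h)
    simp [this]
  have hall : ∀ b, e.symm (a, b) ∈ B := fun b => hdep _ _ (hagree b0 b) h0
  simp only [hall, indicator_of_mem]
  rw [lintegral_const, measure_univ, mul_one]
  have hkey : ∀ z : ℝ, ∀ σ : ℝ, |σ| = 1 → ENNReal.ofReal (σ * dev μ m z (e.symm (a, b0)) - v) ≤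
      ∫⁻ b, ENNReal.ofReal (Ysup μ n (e.symm (a, b)) - v) ∂(Measure.pi fun _ : {s : Fin n // ¬ (s:ℕ) < m} => μ) := by
    intro z σ hσ
    have hbm : ∀ s, Measurable fun b : {s : Fin n // ¬ (s:ℕ) < m} → ℝ => e.symm (a, b) s := fun s =>
      (measurable_pi_apply s).comp (e.symm.measurable.comp measurable_prodMk_left)
    have hti : ∀ s : Fin n, Integrable (fun b => (Iic z).indicator (fun _ => (1:ℝ)) (e.symm (a, b) s) - cdfOf μ z)
        (Measure.pi fun _ : {s : Fin n // ¬ (s:ℕ) < m} => μ) := by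
      intro s
      refine Integrable.sub ?_ (integrable_const _)
      refine Integrable.of_bound (C := 1) ?_ ?_
      · exact ((measurable_const.indicator measurableSet_Iic).comp (hbm s)).aestronglyMeasurable
      · refine Filter.Eventually.of_forall fun b => ?_
        by_cases h : e.symm (a, b) s ≤ z <;> simp [Set.indicator_apply, h]
    have hdn : ∀ ω : Fin n → ℝ, dev μ n z ω = ∑ s : Fin n, ((Iic z).indicator (fun _ => (1:ℝ)) (ω s) - cdfOf μ z) := by
      intro ω
      simp [dev]
    have hint : Integrable (fun b => dev μ n z (e.symm (a, b))) (Measure.pi fun _ : {s : Fin n // ¬ (s:ℕ) < m} => μ) := by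
      simp only [hdn]
      exact integrable_finsetSum _ fun s _ => hti s
    have hval : ∫ b, dev μ n z (e.symm (a, b)) ∂(Measure.pi fun _ : {s : Fin n // ¬ (s:ℕ) < m} => μ)
        = dev μ m z (e.symm (a, b0)) := by
      simp only [hdn]
      rw [integral_finsetSum _ fun s _ => hti s]
      unfold dev
      refine Finset.sum_congr rfl fun s _ => ?_
      split_ifs with hs
      · simp only [hes, dif_pos hs]
        simp
      · simp only [hes, dif_neg hs]
        have := integral_comp_eval (μ := fun _ : {s : Fin n // ¬ (s:ℕ) < m} => μ) (i := ⟨s, hs⟩)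
          (f := fun w : ℝ => (Iic z).indicator (fun _ => (1:ℝ)) w - cdfOf μ z)
          ((measurable_const.indicator measurableSet_Iic).sub_const _).aestronglyMeasurable
        rw [this, integral_sub ((integrable_const _).indicator measurableSet_Iic) (integrable_const _),
          integral_indicator measurableSet_Iic]
        simp [cdfOf, measureReal_def]
    have h1 : ∫ b, (σ * dev μ n z (e.symm (a, b)) - v) ∂(Measure.pi fun _ : {s : Fin n // ¬ (s:ℕ) < m} => μ)
        = σ * dev μ m z (e.symm (a, b0)) - v := by
      rw [integral_sub (hint.const_mul σ) (integrable_const _), integral_const_mul, hval]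
      simp
    rw [← h1]
    refine (ofReal_integral_le _ _ ((hint.const_mul σ).sub (integrable_const _))).trans ?_
    refine lintegral_mono fun b => ENNReal.ofReal_le_ofReal ?_
    have h2 := dev_le_Ysup μ n z (e.symm (a, b))
    have h3 := le_abs_self (σ * dev μ n z (e.symm (a, b)))
    rw [abs_mul, hσ, one_mul] at h3
    simp only [Pi.sub_apply]
    linarith
  refine le_of_forall_lt_imp_le_of_dense fun c hc => ?_
  have hct : c ≠ ⊤ := ne_top_of_lt hc
  have hc1 : c.toReal < x - v := (ENNReal.lt_ofReal_iff_toReal_lt hct).1 hc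
  have hc2 : c.toReal + v < Ysup μ m (e.symm (a, b0)) := by
    have := hBx _ h0
    linarith
  obtain ⟨q, hq⟩ := (lt_Ysup μ m _ _).1 hc2
  rw [← ENNReal.ofReal_toReal hct]
  rcases lt_abs.1 hq with h | h
  · refine le_trans (ENNReal.ofReal_le_ofReal ?_) (hkey q 1 (by simp))
    linarith
  · refine le_trans (ENNReal.ofReal_le_ofReal ?_) (hkey q (-1) (by simp))
    linarith

theorem doob_all (μ : Measure ℝ) [IsProbabilityMeasure μ] (n : ℕ) (x v : ℝ) :
    ENNReal.ofReal (x - v) * (Measure.pi fun _ : Fin n => μ) {ω | ∃ t : ℕ, 1 ≤ t ∧ t ≤ n ∧ x ≤ Ysup μ t ω}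
      ≤ ∫⁻ ω, ENNReal.ofReal (Ysup μ n ω - v) ∂(Measure.pi fun _ : Fin n => μ) := by
  let B : ℕ → Set (Fin n → ℝ) := fun m => {ω | x ≤ Ysup μ m ω ∧ ∀ j : ℕ, 1 ≤ j → j < m → Ysup μ j ω < x}
  have hBm : ∀ m, MeasurableSet (B m) := by
    intro m
    have : B m = {ω | x ≤ Ysup μ m ω} ∩ ⋂ j ∈ Finset.Ico 1 m, {ω : Fin n → ℝ | Ysup μ j ω < x} := by
      ext ω
      simp [B]
    rw [this]
    refine (measurableSet_le measurable_const (Ysup_meas μ m)).inter ?_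
    exact Finset.measurableSet_biInter _ fun j _ => measurableSet_lt (Ysup_meas μ j) measurable_const
  have hU : {ω : Fin n → ℝ | ∃ t : ℕ, 1 ≤ t ∧ t ≤ n ∧ x ≤ Ysup μ t ω} = ⋃ m ∈ Finset.Icc 1 n, B m := by
    ext ω
    simp only [Set.mem_ofPred_eq, mem_iUnion, B]
    constructor
    · intro h
      classical
      refine ⟨Nat.find h, ?_, (Nat.find_spec h).2.2, ?_⟩
      · rw [Finset.mem_Icc]
        exact ⟨(Nat.find_spec h).1, (Nat.find_spec h).2.1⟩
      · intro j hj hjm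
        by_contra hc
        exact Nat.find_min h hjm ⟨hj, hjm.le.trans (Nat.find_spec h).2.1, not_lt.1 hc⟩
    · rintro ⟨m, hm, h, _⟩
      rw [Finset.mem_Icc] at hm
      exact ⟨m, hm.1, hm.2, h⟩
  have hd : ∀ i j : ℕ, 1 ≤ i → i < j → Disjoint (B i) (B j) := by
    intro i j hi hij
    rw [Set.disjoint_left]
    intro ω h1 h2
    exact absurd h1.1 (not_le.2 (h2.2 i hi hij))
  have hpd : Set.PairwiseDisjoint (↑(Finset.Icc 1 n)) B := by
    intro i hi j hj hij
    simp only [Finset.coe_Icc, mem_Icc] at hi hj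
    rcases lt_or_gt_of_ne hij with h | h
    · exact hd i j hi.1 h
    · exact (hd j i hj.1 h).symm
  rw [hU, measure_biUnion_finset hpd (fun m _ => hBm m), Finset.mul_sum]
  refine le_trans (Finset.sum_le_sum fun m hm => doob_step μ n m (Finset.mem_Icc.1 hm).2 (B m) (hBm m) ?_ x v ?_) ?_
  · rintro ω ω' h ⟨h1, h2⟩
    refine ⟨by rwa [← Ysup_congr μ m ω ω' h], fun j hj hjm => ?_⟩
    rw [← Ysup_congr μ j ω ω' fun s hs => h s (hs.trans hjm)]
    exact h2 j hj hjm
  · exact fun ω h => h.1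
  · rw [← lintegral_biUnion_finset hpd (fun m _ => hBm m)]
    exact setLIntegral_le_lintegral _ _


theorem layer (μ : Measure ℝ) [IsProbabilityMeasure μ] (n : ℕ) (hn : 0 < n) (v : ℝ) (hv : 0 < v)
    (hY : 0.7 ≤ v ^ 2 / n) :
    ∫⁻ ω, ENNReal.ofReal (Ysup μ n ω - v) ∂(Measure.pi fun _ : Fin n => μ)
      ≤ ENNReal.ofReal (3.2 * Real.exp (-(2 * v ^ 2 / n)) * (n / (4 * v))) := by
  have hn' : (0:ℝ) < n := by exact_mod_cast hn
  have h1 : ∀ ω : Fin n → ℝ, ENNReal.ofReal (Ysup μ n ω - v) = ENNReal.ofReal (max (Ysup μ n ω - v) 0) := by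
    intro ω
    rw [ENNReal.ofReal_max]; simp
  simp_rw [h1]
  rw [lintegral_eq_lintegral_meas_lt (f := fun ω : Fin n → ℝ => max (Ysup μ n ω - v) 0) _ (Filter.Eventually.of_forall fun ω => le_max_right _ _)
    (((Ysup_meas μ n).sub_const v).max measurable_const).aemeasurable]
  have ha : -(4 * v / n) < 0 := by
    have : 0 < 4 * v / n := by positivity
    linarith
  have hint : IntegrableOn (fun t : ℝ => 3.2 * Real.exp (-(2 * v ^ 2 / n)) * Real.exp (-(4 * v / n) * t)) (Ioi 0) :=
    (integrableOn_exp_mul_Ioi ha 0).const_mul _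
  have hval : ∫ t in Ioi (0:ℝ), 3.2 * Real.exp (-(2 * v ^ 2 / n)) * Real.exp (-(4 * v / n) * t)
      = 3.2 * Real.exp (-(2 * v ^ 2 / n)) * (n / (4 * v)) := by
    rw [integral_const_mul, integral_exp_mul_Ioi ha]
    simp
  rw [← hval, ofReal_integral_eq_lintegral_ofReal hint (Filter.Eventually.of_forall fun t => by positivity)]
  refine setLIntegral_mono' measurableSet_Ioi fun t ht => ?_
  have ht : 0 < t := ht
  have hsq : v ^ 2 ≤ (v + t) ^ 2 := by nlinarith
  have hb := tail_bound μ n (v + t) (by linarith) (hY.trans (by gcongr))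
  refine (measure_mono ?_).trans (hb.trans (ENNReal.ofReal_le_ofReal ?_))
  · intro ω hω
    simp only [Set.mem_ofPred_eq] at hω ⊢
    rcases lt_max_iff.1 hω with h | h
    · linarith
    · exact absurd h (not_lt.2 ht.le)
  · rw [mul_assoc, ← Real.exp_add]
    gcongr
    have : 2 * (v + t) ^ 2 / n = 2 * v ^ 2 / n + 4 * v / n * t + 2 * t ^ 2 / n := by ring
    rw [this]
    have : 0 ≤ 2 * t ^ 2 / n := by positivity
    linarith

theorem exp_132 : (3.74:ℝ) ≤ Real.exp 1.32 := by
  have h1 := Real.exp_one_gt_d9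
  have h2 := Real.sum_le_exp_of_nonneg (x := 0.32) (by norm_num) 4
  norm_num [Finset.sum_range_succ, Nat.factorial] at h2
  rw [show (1.32:ℝ) = 1 + 8/25 by norm_num, Real.exp_add]
  nlinarith

theorem max_bound (μ : Measure ℝ) [IsProbabilityMeasure μ] (n : ℕ) (hn : 0 < n) (x : ℝ) (hx : 0 < x)
    (hy : 2.32 ≤ 2 * x ^ 2 / n) :
    (Measure.pi fun _ : Fin n => μ) {ω | ∃ t : ℕ, 1 ≤ t ∧ t ≤ n ∧ x ≤ Ysup μ t ω}
      ≤ ENNReal.ofReal (Real.exp (2.32 - 2 * x ^ 2 / n)) := by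
  have hn' : (0:ℝ) < n := by exact_mod_cast hn
  obtain ⟨y, hyd⟩ : ∃ y, y = 2 * x ^ 2 / n := ⟨_, rfl⟩
  obtain ⟨s, hs⟩ : ∃ s, s = 1 / (2 * y) := ⟨_, rfl⟩
  rw [← hyd] at hy ⊢
  have hy0 : 0 < y := by linarith
  have hs0 : 0 < s := by rw [hs]; positivity
  have hs1 : s ≤ 0.2156 := by
    rw [hs, div_le_iff₀ (by positivity)]; linarith
  have hys : y * s = 1 / 2 := by rw [hs]; field_simp
  have hx2 : 2 * x ^ 2 = y * n := by rw [hyd]; field_simp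
  obtain ⟨v, hvd⟩ : ∃ v, v = x * (1 - s) := ⟨_, rfl⟩
  have hv : 0 < v := by rw [hvd]; apply mul_pos hx; linarith
  have hv2 : v ^ 2 / n = y * (1 - s) ^ 2 / 2 := by
    rw [hvd, div_eq_iff hn'.ne']; nlinarith
  have hv3 : 2 * v ^ 2 / n = y - 1 + s / 2 := by
    rw [mul_div_assoc, hv2]; nlinarith
  have hY : 0.7 ≤ v ^ 2 / n := by
    have : v ^ 2 / n = (y - 1 + s / 2) / 2 := by rw [← hv3]; ring
    rw [this]
    nlinarith
  have h := (doob_all μ n x v).trans (layer μ n hn v hv hY)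
  have hxv : x - v = x * s := by rw [hvd]; ring
  have hpos : 0 < x * s := by positivity
  rw [hxv] at h
  have hxs : (n:ℝ) / (4 * v) = x * s * (1 / (1 - s)) := by
    have : 1 - s ≠ 0 := by intro h; linarith
    rw [hvd]
    have h4 : (n:ℝ) = 4 * x ^ 2 * s := by
      have : y * n * s = n / 2 := by rw [mul_right_comm, hys]; ring
      nlinarith
    rw [h4]
    field_simp
  rw [hxs, show 3.2 * Real.exp (-(2 * v ^ 2 / n)) * (x * s * (1 / (1 - s))) =
    (x * s) * (3.2 * Real.exp (-(2 * v ^ 2 / n)) * (1 / (1 - s))) by ring, ENNReal.ofReal_mul hpos.le] at h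
  have h' := (ENNReal.mul_le_mul_iff_right (by simpa using hpos) ENNReal.ofReal_ne_top).1 h
  refine h'.trans (ENNReal.ofReal_le_ofReal ?_)
  have h1s : 0 < 1 - s := by linarith
  rw [hv3, mul_one_div, div_le_iff₀ h1s]
  have e1 : Real.exp (2.32 - y) = Real.exp (-(y - 1 + s / 2)) * (Real.exp 1.32 * Real.exp (s / 2)) := by
    rw [← Real.exp_add, ← Real.exp_add]; congr 1; ring
  rw [e1, mul_comm 3.2, mul_assoc]
  gcongr
  have e2 := exp_132
  have e3 := Real.add_one_le_exp (s / 2)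
  calc (3.2:ℝ) ≤ 3.74 * (s / 2 + 1) * (1 - s) := by nlinarith
    _ ≤ _ := by gcongr

theorem log_ge (X b : ℝ) (hX : 0 < X) : b + 1 - Real.exp b / X ≤ Real.log X := by
  have := Real.log_le_sub_one_of_pos (show 0 < Real.exp b / X by positivity)
  rw [Real.log_div (by positivity) hX.ne', Real.log_exp] at this
  linarith

theorem log_final (r : ℝ) (hr : 0 < r) : 2.32 * r ^ 2 / (1 + r ^ 2) ≤ Real.log (1 + 3.04 * r) := by
  have hX : 0 < 1 + 3.04 * r := by positivity
  have hD : 0 < 1 + r ^ 2 := by positivity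
  have he1 := Real.exp_one_lt_d9
  have he0 := Real.exp_one_gt_d9
  have he2 : Real.exp 2 ≤ 7.3891 := by
    rw [show (2:ℝ) = 1 + 1 by norm_num, Real.exp_add]; nlinarith
  rcases le_or_gt r 0.6 with h | h
  · refine le_trans ?_ (log_ge _ 0 hX)
    rw [Real.exp_zero, show (0:ℝ) + 1 - 1 / (1 + 3.04 * r) = 3.04 * r / (1 + 3.04 * r) by field_simp; ring,
      div_le_div_iff₀ hD hX]
    have : 0 ≤ 3.04 - 2.32 * r - 4.0128 * r ^ 2 := by nlinarith
    nlinarith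
  rcases le_or_gt r 1.2 with h2 | h2
  · refine le_trans ?_ (log_ge _ 1 hX)
    rw [show (1:ℝ) + 1 - Real.exp 1 / (1 + 3.04 * r) = (2 * (1 + 3.04 * r) - Real.exp 1) / (1 + 3.04 * r) by field_simp; ring,
      div_le_div_iff₀ hD hX]
    have : 0 ≤ -0.9728 * r ^ 3 - 3.0383 * r ^ 2 + 6.08 * r - 0.7183 := by
      nlinarith [mul_nonneg (sub_nonneg.2 h.le) (sub_nonneg.2 h2), mul_nonneg hr.le (mul_nonneg (sub_nonneg.2 h.le) (sub_nonneg.2 h2))]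
    nlinarith
  · refine le_trans ?_ (log_ge _ 2 hX)
    rw [show (2:ℝ) + 1 - Real.exp 2 / (1 + 3.04 * r) = (3 * (1 + 3.04 * r) - Real.exp 2) / (1 + 3.04 * r) by field_simp; ring,
      div_le_div_iff₀ hD hX]
    have : 0 ≤ 2.0672 * r ^ 3 - 6.7091 * r ^ 2 + 9.12 * r - 4.3891 := by
      obtain ⟨d, hd⟩ : ∃ d, d = r - 1.2 := ⟨_, rfl⟩
      have hd0 : 0 < d := by linarith
      have : r = d + 1.2 := by linarith
      rw [this]
      ring_nf
      positivity
    nlinarith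

theorem coef_ge (k : ℝ) (hk : 0 < k) :
    1 + 3.04 * Real.sqrt k ≤ 1 + 2 * Real.sqrt (k / Real.exp 1) * Real.sqrt (2 * Real.pi) := by
  have he1 := Real.exp_one_lt_d9
  have hpi := Real.pi_gt_d6
  have : 1.52 * Real.sqrt k ≤ Real.sqrt (k / Real.exp 1) * Real.sqrt (2 * Real.pi) := by
    rw [← Real.sqrt_mul (by positivity)]
    apply Real.le_sqrt_of_sq_le
    rw [mul_pow, Real.sq_sqrt hk.le, div_mul_eq_mul_div, le_div_iff₀ (by positivity)]
    nlinarith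
  linarith


/-- Lemma A.2 of the paper: for `X₁, X₂, …` i.i.d. with cdf `F` and empirical cdfs `F̂_t`,
for every `n ∈ ℕ`, `x > 0` and `k > 0`,
`P(max_{1≤t≤n} t‖F̂_t − F‖_∞ ≥ x) ≤ (1 + 2√(k/e)√(2π))·e^{−2x²/((1+1/k)n)}`. -/
theorem doob_maximal_bound_empirical
    (μ : ProbabilityMeasure ℝ) (n : ℕ) (hn : 0 < n) (x k : ℝ) (hx : 0 < x) (hk : 0 < k) :
    (Measure.pi fun _ : Fin n => (μ : Measure ℝ))
        {ω : Fin n → ℝ | ∃ t : ℕ, 1 ≤ t ∧ t ≤ n ∧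
          x ≤ t * supDist (partialEmpiricalCdf ω t) (cdfOf μ)}
      ≤ ENNReal.ofReal
          ((1 + 2 * Real.sqrt (k / Real.exp 1) * Real.sqrt (2 * Real.pi))
            * Real.exp (-(2 * x ^ 2) / ((1 + 1 / k) * n))) := by
  have hn' : (0:ℝ) < n := by exact_mod_cast hn
  have hset : {ω : Fin n → ℝ | ∃ t : ℕ, 1 ≤ t ∧ t ≤ n ∧
          x ≤ t * supDist (partialEmpiricalCdf ω t) (cdfOf μ)}
      = {ω : Fin n → ℝ | ∃ t : ℕ, 1 ≤ t ∧ t ≤ n ∧ x ≤ Ysup (μ : Measure ℝ) t ω} := by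
    ext ω
    constructor
    · rintro ⟨t, h1, h2, h3⟩
      exact ⟨t, h1, h2, by rwa [← mul_supDist _ t h1 h2]⟩
    · rintro ⟨t, h1, h2, h3⟩
      exact ⟨t, h1, h2, by rwa [mul_supDist _ t h1 h2]⟩
  rw [hset]
  obtain ⟨y, hyd⟩ : ∃ y, y = 2 * x ^ 2 / n := ⟨_, rfl⟩
  have hlog := log_final (Real.sqrt k) (Real.sqrt_pos.2 hk)
  rw [Real.sq_sqrt hk.le] at hlog
  have hX : 0 < 1 + 3.04 * Real.sqrt k := by positivity
  have hexp : -(2 * x ^ 2) / ((1 + 1 / k) * n) = -(y * (k / (1 + k))) := by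
    rw [hyd]; field_simp; ring
  have hq0 : 0 < k / (1 + k) := by positivity
  have hq1 : k / (1 + k) ≤ 1 := by
    rw [div_le_one (by positivity)]; linarith
  rw [mul_div_assoc] at hlog
  have hR : Real.exp (2.32 * (k / (1 + k)) - y * (k / (1 + k))) ≤
      (1 + 2 * Real.sqrt (k / Real.exp 1) * Real.sqrt (2 * Real.pi))
            * Real.exp (-(2 * x ^ 2) / ((1 + 1 / k) * n)) := by
    rw [hexp, sub_eq_add_neg, Real.exp_add]
    gcongr
    exact ((Real.le_log_iff_exp_le hX).1 hlog).trans (coef_ge k hk)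
  refine le_trans ?_ (ENNReal.ofReal_le_ofReal hR)
  rcases le_or_gt 2.32 y with h | h
  · refine (max_bound (μ : Measure ℝ) n hn x hx (by rwa [← hyd])).trans (ENNReal.ofReal_le_ofReal ?_)
    rw [← hyd]
    apply Real.exp_le_exp.2
    nlinarith
  · refine prob_le_one.trans ?_
    rw [ENNReal.one_le_ofReal]
    apply Real.one_le_exp
    nlinarith

end TRDT
end
end

section
/- Let X and Y be independent real random variables, each satisfying the sub-Gaussian tail bound P(|X| ≥ x) ≤ D·e^{−x²/(2σ²)} and P(|Y| ≥ x) ≤ D·e^{−x²/(2σ²)} for all x>0, with the same parameters D>0 and σ²>0. Then for every z>0 and every k>0: P(X + Y ≥ z) ≤ (1 + D√(k/e)·√(2π))² · e^{ −z²/(4(1+1/k)σ²) }. -/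
open MeasureTheory ProbabilityTheory

noncomputable section

namespace TRDT

lemma mgf_bound {Ω : Type*} [MeasurableSpace Ω] (P : Measure Ω) [IsProbabilityMeasure P]
    (X : Ω → ℝ) (hX : Measurable X) (D σ : ℝ) (hD : 0 < D) (hσ : 0 < σ)
    (htailX : ∀ x : ℝ, 0 < x →
      P {ω | x ≤ |X ω|} ≤ ENNReal.ofReal (D * Real.exp (-(x ^ 2) / (2 * σ ^ 2))))
    (t : ℝ) (ht : 0 < t) :
    ∫⁻ ω, ENNReal.ofReal (Real.exp (t * X ω)) ∂P
      ≤ ENNReal.ofReal (1 + D * (t * σ * Real.exp ((t * σ) ^ 2 / 2)) * Real.sqrt (2 * Real.pi)) := by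
  have hint : ∀ y : ℝ, ∫ x in (0:ℝ)..y, t * Real.exp (t * x) = Real.exp (t * y) - 1 := by
    intro y
    have := intervalIntegral.integral_eq_sub_of_hasDerivAt (a := 0) (b := y)
      (f := fun x => Real.exp (t * x)) (f' := fun x => t * Real.exp (t * x))
      (fun x _ => by
        have h := ((hasDerivAt_id x).const_mul t).exp
        simp only [id, mul_one] at h
        rw [mul_comm]
        exact h)
      (Continuous.intervalIntegrable (by fun_prop) _ _)
    rw [this]
    simp
  have key := lintegral_comp_eq_lintegral_meas_le_mul P (f := fun ω => |X ω|)
    (g := fun x => t * Real.exp (t * x))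
    (Filter.Eventually.of_forall fun ω => abs_nonneg _) (hX.abs.aemeasurable)
    (fun y _ => Continuous.intervalIntegrable (by fun_prop) _ _)
    (Filter.Eventually.of_forall fun x => by positivity)
  simp only [hint] at key
  set v : NNReal := ⟨σ ^ 2, by positivity⟩ with hv
  have hvc : (v : ℝ) = σ ^ 2 := rfl
  have hv0 : v ≠ 0 := by
    intro h
    have : (v : ℝ) = 0 := by rw [h]; rfl
    rw [hvc] at this
    have : 0 < σ ^ 2 := by positivity
    linarith
  set C := D * (t * σ * Real.exp ((t * σ) ^ 2 / 2)) * Real.sqrt (2 * Real.pi) with hC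
  have hC0 : 0 ≤ C := by positivity
  have hsq : Real.sqrt (2 * Real.pi * σ ^ 2) = Real.sqrt (2 * Real.pi) * σ := by
    rw [Real.sqrt_mul (by positivity), Real.sqrt_sq hσ.le]
  have hpt : ∀ x : ℝ, D * Real.exp (-(x ^ 2) / (2 * σ ^ 2)) * (t * Real.exp (t * x))
      = C * gaussianPDFReal (t * σ ^ 2) v x := by
    intro x
    have he : Real.exp (-(x ^ 2) / (2 * σ ^ 2)) * Real.exp (t * x)
        = Real.exp ((t * σ) ^ 2 / 2) * Real.exp (-(x - t * σ ^ 2) ^ 2 / (2 * σ ^ 2)) := by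
      rw [← Real.exp_add, ← Real.exp_add]
      congr 1
      field_simp
      ring
    have hs : 0 < Real.sqrt (2 * Real.pi) := by positivity
    rw [gaussianPDFReal, hvc, hsq, hC]
    calc _ = D * t * (Real.exp (-(x ^ 2) / (2 * σ ^ 2)) * Real.exp (t * x)) := by ring
      _ = _ := by
        rw [he]
        field_simp
  have hb : ∫⁻ ω, ENNReal.ofReal (Real.exp (t * |X ω|) - 1) ∂P ≤ ENNReal.ofReal C := by
    rw [key]
    calc _ ≤ ∫⁻ x in Set.Ioi (0:ℝ), ENNReal.ofReal C * gaussianPDF (t * σ ^ 2) v x := by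
          apply setLIntegral_mono' measurableSet_Ioi
          intro x hx
          rw [gaussianPDF, ← ENNReal.ofReal_mul hC0, ← hpt,
            ENNReal.ofReal_mul (p := D * Real.exp (-(x ^ 2) / (2 * σ ^ 2))) (by positivity)]
          exact mul_le_mul_left (htailX x hx) _
      _ ≤ ∫⁻ x, ENNReal.ofReal C * gaussianPDF (t * σ ^ 2) v x := setLIntegral_le_lintegral _ _
      _ = _ := by
          rw [lintegral_const_mul _ (measurable_gaussianPDF _ _),
            lintegral_gaussianPDF_eq_one _ hv0, mul_one]
  calc _ ≤ ∫⁻ ω, (1 + ENNReal.ofReal (Real.exp (t * |X ω|) - 1)) ∂P := by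
        apply lintegral_mono
        intro ω
        have h1 : t * X ω ≤ t * |X ω| := by gcongr; exact le_abs_self _
        have h0 : 0 ≤ Real.exp (t * |X ω|) - 1 := by
          have := Real.one_le_exp (x := t * |X ω|) (by positivity)
          linarith
        simp only
        rw [← ENNReal.ofReal_one, ← ENNReal.ofReal_add zero_le_one h0]
        apply ENNReal.ofReal_le_ofReal
        have := Real.exp_le_exp.2 h1
        linarith
    _ = 1 + ∫⁻ ω, ENNReal.ofReal (Real.exp (t * |X ω|) - 1) ∂P := by
        rw [lintegral_add_left measurable_const]; simp
    _ ≤ 1 + ENNReal.ofReal C := by gcongr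
    _ = _ := by rw [ENNReal.ofReal_add zero_le_one hC0, ENNReal.ofReal_one]

lemma aux_max (s k : ℝ) (hs : 0 < s) (hk : 0 < k) :
    s * Real.exp (s ^ 2 / 2) ≤ Real.sqrt (k / Real.exp 1) * Real.exp ((1 + 1 / k) * s ^ 2 / 2) := by
  have h : s ≤ Real.sqrt (k / Real.exp 1) * Real.exp (s ^ 2 / (2 * k)) := by
    have h1 : Real.exp (s ^ 2 / (2 * k)) = Real.sqrt (Real.exp (s ^ 2 / k)) := by
      symm
      rw [Real.sqrt_eq_iff_mul_self_eq (by positivity) (by positivity), ← Real.exp_add]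
      congr 1; field_simp; ring
    rw [h1, ← Real.sqrt_mul (by positivity)]
    apply Real.le_sqrt_of_sq_le
    have h2 := Real.add_one_le_exp (s ^ 2 / k - 1)
    rw [Real.exp_sub] at h2
    calc s ^ 2 = k * (s ^ 2 / k - 1 + 1) := by field_simp; ring
      _ ≤ k * (Real.exp (s ^ 2 / k) / Real.exp 1) := by gcongr
      _ = _ := by ring
  calc _ ≤ Real.sqrt (k / Real.exp 1) * Real.exp (s ^ 2 / (2 * k)) * Real.exp (s ^ 2 / 2) := by gcongr
    _ = _ := by
      rw [mul_assoc, ← Real.exp_add]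
      congr 2; field_simp; ring

lemma mgf_bound' {Ω : Type*} [MeasurableSpace Ω] (P : Measure Ω) [IsProbabilityMeasure P]
    (X : Ω → ℝ) (hX : Measurable X) (D σ : ℝ) (hD : 0 < D) (hσ : 0 < σ)
    (htailX : ∀ x : ℝ, 0 < x →
      P {ω | x ≤ |X ω|} ≤ ENNReal.ofReal (D * Real.exp (-(x ^ 2) / (2 * σ ^ 2))))
    (t k : ℝ) (ht : 0 < t) (hk : 0 < k) :
    ∫⁻ ω, ENNReal.ofReal (Real.exp (t * X ω)) ∂P
      ≤ ENNReal.ofReal ((1 + D * Real.sqrt (k / Real.exp 1) * Real.sqrt (2 * Real.pi))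
        * Real.exp ((1 + 1 / k) * (t * σ) ^ 2 / 2)) := by
  refine (mgf_bound P X hX D σ hD hσ htailX t ht).trans (ENNReal.ofReal_le_ofReal ?_)
  have h1 := aux_max (t * σ) k (by positivity) hk
  have h2 := Real.one_le_exp (x := (1 + 1 / k) * (t * σ) ^ 2 / 2) (by positivity)
  have h3 : D * (t * σ * Real.exp ((t * σ) ^ 2 / 2)) * Real.sqrt (2 * Real.pi) ≤
    D * (Real.sqrt (k / Real.exp 1) * Real.exp ((1 + 1 / k) * (t * σ) ^ 2 / 2))
      * Real.sqrt (2 * Real.pi) := by gcongr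
  linarith


/-- Lemma A.3 of the paper: if `X` and `Y` are independent and both sub-Gaussian with the
same parameters `D` and `σ²`, then for every `z > 0` and `k > 0`,
`P(X + Y ≥ z) ≤ (1 + D√(k/e)√(2π))²·e^{−z²/(4(1+1/k)σ²)}`. -/
theorem tail_bound_sum_of_indep_subGaussian
    {Ω : Type*} [MeasurableSpace Ω] (P : Measure Ω) [IsProbabilityMeasure P]
    (X Y : Ω → ℝ) (hX : Measurable X) (hY : Measurable Y)
    (hindep : IndepFun X Y P)
    (D σ : ℝ) (hD : 0 < D) (hσ : 0 < σ)
    (htailX : ∀ x : ℝ, 0 < x →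
      P {ω | x ≤ |X ω|} ≤ ENNReal.ofReal (D * Real.exp (-(x ^ 2) / (2 * σ ^ 2))))
    (htailY : ∀ x : ℝ, 0 < x →
      P {ω | x ≤ |Y ω|} ≤ ENNReal.ofReal (D * Real.exp (-(x ^ 2) / (2 * σ ^ 2)))) :
    ∀ z k : ℝ, 0 < z → 0 < k →
      P {ω | z ≤ X ω + Y ω}
        ≤ ENNReal.ofReal
            ((1 + D * Real.sqrt (k / Real.exp 1) * Real.sqrt (2 * Real.pi)) ^ 2
              * Real.exp (-(z ^ 2) / (4 * (1 + 1 / k) * σ ^ 2))) := by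
  intro z k hz hk
  set t := z / (2 * (1 + 1 / k) * σ ^ 2) with ht_def
  have ht : 0 < t := by positivity
  set A := 1 + D * Real.sqrt (k / Real.exp 1) * Real.sqrt (2 * Real.pi) with hA
  have hA0 : 0 < A := by positivity
  have bX := mgf_bound' P X hX D σ hD hσ htailX t k ht hk
  have bY := mgf_bound' P Y hY D σ hD hσ htailY t k ht hk
  rw [← hA] at bX bY
  set B := A * Real.exp ((1 + 1 / k) * (t * σ) ^ 2 / 2) with hB
  have hB0 : 0 < B := by positivity
  have hm : Measurable fun x : ℝ => ENNReal.ofReal (Real.exp (t * x)) := by fun_prop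
  have hprod := lintegral_mul_eq_lintegral_mul_lintegral_of_indepFun (μ := P)
    (hm.comp hX) (hm.comp hY) (hindep.comp hm hm)
  have h1 : P {ω | z ≤ X ω + Y ω} ≤ ∫⁻ ω, ENNReal.ofReal (Real.exp (-(t * z))) *
      (ENNReal.ofReal (Real.exp (t * X ω)) * ENNReal.ofReal (Real.exp (t * Y ω))) ∂P := by
    have hms : MeasurableSet {ω | z ≤ X ω + Y ω} :=
      measurableSet_le measurable_const (hX.add hY)
    rw [← lintegral_indicator_one hms]
    apply lintegral_mono
    intro ω
    by_cases h : z ≤ X ω + Y ω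
    · rw [Set.indicator_of_mem (by exact h)]
      beta_reduce
      rw [← ENNReal.ofReal_mul (by positivity), ← ENNReal.ofReal_mul (by positivity),
        ← Real.exp_add, ← Real.exp_add, Pi.one_apply, ← ENNReal.ofReal_one]
      apply ENNReal.ofReal_le_ofReal
      apply Real.one_le_exp
      nlinarith
    · rw [Set.indicator_of_notMem (by exact h)]
      exact zero_le
  refine h1.trans ?_
  rw [lintegral_const_mul _ (by fun_prop)]
  calc _ = ENNReal.ofReal (Real.exp (-(t * z))) *
        ((∫⁻ ω, ENNReal.ofReal (Real.exp (t * X ω)) ∂P) *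
          ∫⁻ ω, ENNReal.ofReal (Real.exp (t * Y ω)) ∂P) := by
        congr 1
    _ ≤ ENNReal.ofReal (Real.exp (-(t * z))) * (ENNReal.ofReal B * ENNReal.ofReal B) := by gcongr
    _ = _ := by
      rw [← ENNReal.ofReal_mul hB0.le, ← ENNReal.ofReal_mul (by positivity)]
      congr 1
      have he : Real.exp (-(z ^ 2) / (4 * (1 + 1 / k) * σ ^ 2)) =
          Real.exp (-(t * z)) * (Real.exp ((1 + 1 / k) * (t * σ) ^ 2 / 2) *
            Real.exp ((1 + 1 / k) * (t * σ) ^ 2 / 2)) := by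
        rw [← Real.exp_add, ← Real.exp_add]
        congr 1
        have hq : 0 < 1 + 1 / k := by positivity
        rw [ht_def]
        generalize 1 + 1 / k = q at hq
        field_simp
        ring
      rw [he, hB]
      ring

end TRDT
end
end

section
/- Let c > 0. Then the function x ↦ log(1 + c·√(log x)·x) / log(x) is strictly decreasing on the interval (e^{e/c²}, ∞). (Equivalently, x ↦ log(1 + c·x·e^{x²})/x² is strictly decreasing on (√e/c, ∞).) -/
noncomputable section

namespace TRDT

theorem aux_second (c : ℝ) (hc : 0 < c) :
    StrictAntiOn (fun x : ℝ => Real.log (1 + c * x * Real.exp (x ^ 2)) / x ^ 2)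
      (Set.Ioi (Real.sqrt (Real.exp 1) / c)) := by
  have hpos : ∀ x ∈ Set.Ioi (Real.sqrt (Real.exp 1) / c), 0 < x := fun x hx =>
    lt_of_le_of_lt (by positivity) hx
  have hd : ∀ x : ℝ, 0 < x → HasDerivAt
      (fun x : ℝ => Real.log (1 + c * x * Real.exp (x ^ 2)) / x ^ 2)
      (((c * Real.exp (x ^ 2) + c * x * (Real.exp (x ^ 2) * (2 * x))) /
        (1 + c * x * Real.exp (x ^ 2)) * x ^ 2 -
        Real.log (1 + c * x * Real.exp (x ^ 2)) * (2 * x)) / (x ^ 2) ^ 2) x := by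
    intro x hx
    have h2 : HasDerivAt (fun x : ℝ => x ^ 2) (2 * x) x := by
      simpa using hasDerivAt_pow 2 x
    have h1 : HasDerivAt (fun x : ℝ => c * x) c x := by
      simpa using (hasDerivAt_id x).const_mul c
    have h3 := ((h1.mul h2.exp).const_add 1).log
      (by simp only [Pi.mul_apply]; positivity)
    exact h3.div h2 (by positivity)
  apply strictAntiOn_of_deriv_neg (convex_Ioi _)
  · intro x hx
    exact (hd x (hpos x hx)).continuousAt.continuousWithinAt
  · intro x hx
    rw [interior_Ioi] at hx
    have hx0 := hpos x hx
    rw [(hd x hx0).deriv]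
    have hcx : Real.sqrt (Real.exp 1) < c * x := by
      have := (div_lt_iff₀ hc).1 (Set.mem_Ioi.1 hx)
      linarith
    have hl : 1 / 2 < Real.log (c * x) := by
      have := Real.log_lt_log (by positivity) hcx
      rwa [Real.log_sqrt (by positivity), Real.log_exp] at this
    set u := c * x * Real.exp (x ^ 2) with hu
    have hu0 : 0 < u := by positivity
    have hlu : Real.log u = Real.log (c * x) + x ^ 2 := by
      rw [hu, Real.log_mul (by positivity) (by positivity), Real.log_exp]
    have hlt : Real.log u < Real.log (1 + u) := Real.log_lt_log hu0 (by linarith)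
    apply div_neg_of_neg_of_pos _ (by positivity)
    have e : (c * Real.exp (x ^ 2) + c * x * (Real.exp (x ^ 2) * (2 * x))) / (1 + u) * x ^ 2
        = x * (1 + 2 * x ^ 2) * (u / (1 + u)) := by
      rw [hu]; field_simp
    rw [e]
    have h1 : u / (1 + u) < 1 := by rw [div_lt_one (by linarith)]; linarith
    have h2 : x * (1 + 2 * x ^ 2) * (u / (1 + u)) < x * (1 + 2 * x ^ 2) * 1 :=
      mul_lt_mul_of_pos_left h1 (by positivity)
    have h3 : x * (1 + 2 * x ^ 2) < x * (2 * Real.log (1 + u)) :=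
      mul_lt_mul_of_pos_left (by linarith) hx0
    linarith

/-- Lemma C.2 of the paper: for `c > 0` the map `x ↦ log(1 + c√(log x)·x)/log x` is
strictly decreasing on `(e^{e/c²}, ∞)`; equivalently, `x ↦ log(1 + c·x·e^{x²})/x²` is
strictly decreasing on `(√e/c, ∞)`. -/
theorem strictAntiOn_log_ratio (c : ℝ) (hc : 0 < c) :
    StrictAntiOn (fun x : ℝ => Real.log (1 + c * Real.sqrt (Real.log x) * x) / Real.log x)
      (Set.Ioi (Real.exp (Real.exp 1 / c ^ 2))) ∧
    StrictAntiOn (fun x : ℝ => Real.log (1 + c * x * Real.exp (x ^ 2)) / x ^ 2)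
      (Set.Ioi (Real.sqrt (Real.exp 1) / c)) := by
  refine ⟨?_, aux_second c hc⟩
  have key : ∀ x ∈ Set.Ioi (Real.exp (Real.exp 1 / c ^ 2)), 0 < x ∧
      Real.exp 1 / c ^ 2 < Real.log x := by
    intro x hx
    have hx0 : 0 < x := lt_trans (Real.exp_pos _) hx
    exact ⟨hx0, (Real.lt_log_iff_exp_lt hx0).2 hx⟩
  have hm : ∀ x ∈ Set.Ioi (Real.exp (Real.exp 1 / c ^ 2)),
      Real.sqrt (Real.log x) ∈ Set.Ioi (Real.sqrt (Real.exp 1) / c) := by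
    intro x hx
    have h := Real.sqrt_lt_sqrt (by positivity) (key x hx).2
    rwa [Real.sqrt_div (by positivity), Real.sqrt_sq hc.le] at h
  intro x hx y hy hxy
  have hlx : 0 < Real.log x := lt_trans (by positivity) (key x hx).2
  have hly : 0 < Real.log y := lt_trans (by positivity) (key y hy).2
  have := aux_second c hc (hm x hx) (hm y hy)
    (Real.sqrt_lt_sqrt hlx.le (Real.log_lt_log (key x hx).1 hxy))
  simpa only [Real.sq_sqrt hlx.le, Real.sq_sqrt hly.le, Real.exp_log (key x hx).1,
    Real.exp_log (key y hy).1] using this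

end TRDT
end
end

section
/- Let μ, γ ∈ ℝ^K with the Euclidean norm ‖·‖ satisfy ‖γ‖ ≤ ‖μ‖, ‖μ‖·‖γ‖ ≤ 1, and ‖μ − γ‖² ≥ d²/4 for some d with 0 < d ≤ 1. Then μ'γ ≤ ‖μ‖² − ‖μ‖²·d²/16, i.e., ‖μ‖² − μ'γ ≥ ‖μ‖²·d²/16, where μ'γ denotes the Euclidean inner product. -/
noncomputable section

namespace TRDT

open scoped RealInnerProductSpace

/-- The key geometric inequality (eq. (B.8)-(B.10)) from the proof of Theorem 2:
if `‖γ‖ ≤ ‖μ‖`, `‖μ‖·‖γ‖ ≤ 1` and `‖μ - γ‖² ≥ d²/4` with `0 < d ≤ 1`, then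
`μ'γ ≤ ‖μ‖² − ‖μ‖²·d²/16`, i.e. `‖μ‖² − μ'γ ≥ ‖μ‖²·d²/16`. -/
theorem inner_le_of_sq_dist_ge (K : ℕ) (μ γ : EuclideanSpace ℝ (Fin K)) (d : ℝ)
    (hd0 : 0 < d) (hd1 : d ≤ 1)
    (hnorm : ‖γ‖ ≤ ‖μ‖) (hprod : ‖μ‖ * ‖γ‖ ≤ 1)
    (hdist : d ^ 2 / 4 ≤ ‖μ - γ‖ ^ 2) :
    ⟪μ, γ⟫ ≤ ‖μ‖ ^ 2 - ‖μ‖ ^ 2 * d ^ 2 / 16 ∧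
    ‖μ‖ ^ 2 * d ^ 2 / 16 ≤ ‖μ‖ ^ 2 - ⟪μ, γ⟫ := by
  have h1 := norm_sub_sq_real μ γ
  have hm := norm_nonneg μ
  have hg := norm_nonneg γ
  have hd2 : d ^ 2 ≤ 1 := by nlinarith
  have hd3 : 0 ≤ d ^ 2 := sq_nonneg d
  have hgm : ‖γ‖ ^ 2 ≤ ‖μ‖ ^ 2 := by gcongr
  have hp2 : ‖μ‖ ^ 2 * ‖γ‖ ^ 2 ≤ 1 := by
    rw [← mul_pow]
    exact pow_le_one₀ (by positivity) hprod
  have key : ‖μ‖ ^ 2 * d ^ 2 / 16 ≤ ‖μ‖ ^ 2 - ⟪μ, γ⟫ := by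
    rcases le_total (‖μ‖ ^ 2) 2 with h | h
    · have : ‖μ‖ ^ 2 * d ^ 2 ≤ 2 * d ^ 2 := by gcongr
      linarith
    · have h2 : 2 * ‖γ‖ ^ 2 ≤ ‖μ‖ ^ 2 * ‖γ‖ ^ 2 := by gcongr
      have h3 : ‖μ‖ ^ 2 * d ^ 2 ≤ ‖μ‖ ^ 2 * 1 := by gcongr
      linarith
  exact ⟨by linarith, key⟩

end TRDT
end
end

section
/- Let a<b be real numbers and for F ∈ D_cdf([a,b]) let μ_F denote the associated Borel probability measure on [a,b]. Define the Gini-welfare functional W(F) := ∫ x dμ_F(x) − (1/2)∫∫ |x₁ − x₂| dμ_F(x₁) dμ_F(x₂). Then for every F ∈ D_cdf([a,b]): W(F) = a + ∫_a^b (1 − F(x))² dx. Consequently, W is quasi-convex on D_cdf([a,b]): for all F, G ∈ D_cdf([a,b]) and all α ∈ [0,1], W(αF + (1−α)G) ≤ max(W(F), W(G)). -/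
open MeasureTheory Set intervalIntegral

noncomputable section

open scoped Classical

namespace TRDT

/-- `F` is a cumulative distribution function on `[a,b]`. -/
def IsCdfOn (a b : ℝ) (F : ℝ → ℝ) : Prop :=
  Monotone F ∧ (∀ x, ContinuousWithinAt F (Set.Ici x) x) ∧
    (∀ x, x < a → F x = 0) ∧ (∀ x, b ≤ x → F x = 1)

/-- The Borel measure on `ℝ` associated with a cdf `F` (its Lebesgue–Stieltjes measure). -/
def cdfMeasure (F : ℝ → ℝ) : Measure ℝ :=
  if h : Monotone F ∧ ∀ x, ContinuousWithinAt F (Set.Ici x) x then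
    StieltjesFunction.measure ⟨F, h.1, h.2⟩
  else 0

/-- The Gini-welfare functional
`W(F) = ∫ x dμ_F(x) − (1/2)∫∫ |x₁ − x₂| dμ_F(x₁) dμ_F(x₂)`. -/
def giniWelfare (F : ℝ → ℝ) : ℝ :=
  (∫ x, x ∂(cdfMeasure F))
    - (1 / 2) * ∫ x₁, (∫ x₂, |x₁ - x₂| ∂(cdfMeasure F)) ∂(cdfMeasure F)

open Filter Topology in
theorem welfare_eq (a b : ℝ) (hab : a < b) (F : ℝ → ℝ) (hF : IsCdfOn a b F) :
    giniWelfare F = a + ∫ x in a..b, (1 - F x) ^ 2 := by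
  obtain ⟨hm, hc, h0, h1⟩ := hF
  have hbot : Tendsto F atBot (𝓝 0) := by
    refine tendsto_const_nhds.congr' ?_
    filter_upwards [eventually_lt_atBot a] with x hx using (h0 x hx).symm
  have htop : Tendsto F atTop (𝓝 1) := by
    refine tendsto_const_nhds.congr' ?_
    filter_upwards [eventually_ge_atTop b] with x hx using (h1 x hx).symm
  have hleft : Function.leftLim F a = 0 := by
    apply leftLim_eq_of_tendsto
    refine tendsto_const_nhds.congr' ?_
    filter_upwards [self_mem_nhdsWithin] with x hx using (h0 x hx).symm
  have hF1 : ∀ x, F x ≤ 1 := fun x =>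
    (hm (le_max_left x b)).trans (h1 _ (le_max_right x b)).le
  set f : StieltjesFunction ℝ := ⟨F, hm, hc⟩ with hf
  have hμ : cdfMeasure F = f.measure := by
    unfold cdfMeasure
    rw [dif_pos ⟨hm, hc⟩]
  unfold giniWelfare
  rw [hμ]
  set μ := f.measure with hμdef
  have : IsProbabilityMeasure μ := f.isProbabilityMeasure hbot htop
  have hIoi : ∀ t, μ.real (Ioi t) = 1 - F t := by
    intro t
    rw [Measure.real, hμdef, f.measure_Ioi htop, ENNReal.toReal_ofReal]
    exact sub_nonneg.2 (hF1 t)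
  have hlo : ∀ᵐ x ∂μ, a ≤ x := by
    have : μ (Iio a) = 0 := by
      rw [hμdef, f.measure_Iio hbot]
      have : Function.leftLim f a = 0 := hleft
      simp [this]
    rw [ae_iff]
    simp only [not_le]
    exact this
  have hhi : ∀ᵐ x ∂μ, x ≤ b := by
    have : μ (Ioi b) = 0 := by
      rw [hμdef, f.measure_Ioi htop]
      have : f b = 1 := h1 b le_rfl
      simp [this]
    rw [ae_iff]
    simp only [not_le]
    exact this
  have hid : Integrable (fun x : ℝ => x) μ := by
    refine Integrable.of_bound (by fun_prop) (max |a| |b|) ?_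
    filter_upwards [hlo, hhi] with x hx hy
    exact abs_le_max_abs_abs hx hy
  have i1 : Integrable (fun p : ℝ × ℝ => p.1) (μ.prod μ) := hid.comp_fst μ
  have i2 : Integrable (fun p : ℝ × ℝ => p.2) (μ.prod μ) := hid.comp_snd μ
  have i3 : Integrable (fun p : ℝ × ℝ => |p.1 - p.2|) (μ.prod μ) := (i1.sub i2).abs
  have e1 : ∫ p : ℝ × ℝ, p.1 ∂(μ.prod μ) = ∫ x, x ∂μ := by
    rw [integral_prod _ i1]; simp
  have e2 : ∫ p : ℝ × ℝ, p.2 ∂(μ.prod μ) = ∫ x, x ∂μ := by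
    rw [integral_prod _ i2]; simp
  have e3 := integral_prod _ i3
  simp only at e3
  have hmin : ∀ p : ℝ × ℝ, min p.1 p.2 - a = (1/2) * (p.1 + p.2 - |p.1 - p.2|) - a := by
    intro p
    rcases le_total p.1 p.2 with h | h
    · rw [min_eq_left h, abs_of_nonpos (by linarith)]; ring
    · rw [min_eq_right h, abs_of_nonneg (by linarith)]; ring
  have i4 : Integrable (fun p : ℝ × ℝ => min p.1 p.2 - a) (μ.prod μ) := by
    simp_rw [hmin]
    exact (((i1.add i2).sub i3).const_mul _).sub (integrable_const a)
  have e4 : ∫ p : ℝ × ℝ, (min p.1 p.2 - a) ∂(μ.prod μ)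
      = (∫ x, x ∂μ) - (1/2) * (∫ x₁, (∫ x₂, |x₁ - x₂| ∂μ) ∂μ) - a := by
    simp_rw [hmin]
    have i12 : Integrable (fun p : ℝ × ℝ => p.1 + p.2) (μ.prod μ) := i1.add i2
    have i123 : Integrable (fun p : ℝ × ℝ => (1/2) * (p.1 + p.2 - |p.1 - p.2|)) (μ.prod μ) :=
      (i12.sub i3).const_mul _
    rw [integral_sub i123 (integrable_const a),
      MeasureTheory.integral_const_mul, MeasureTheory.integral_sub i12 i3, integral_add i1 i2, e1, e2, e3]
    simp
    ring
  have hnn : 0 ≤ᵐ[μ.prod μ] (fun p : ℝ × ℝ => min p.1 p.2 - a) := by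
    have q1 : ∀ᵐ p ∂(μ.prod μ), a ≤ p.1 := Measure.quasiMeasurePreserving_fst.ae hlo
    have q2 : ∀ᵐ p ∂(μ.prod μ), a ≤ p.2 := Measure.quasiMeasurePreserving_snd.ae hlo
    filter_upwards [q1, q2] with p h1 h2
    exact sub_nonneg.2 (le_min h1 h2)
  have e5 := i4.integral_eq_integral_meas_lt hnn
  have e6 : ∀ t : ℝ, (μ.prod μ).real {p : ℝ × ℝ | t < min p.1 p.2 - a} = (1 - F (t + a)) ^ 2 := by
    intro t
    have : {p : ℝ × ℝ | t < min p.1 p.2 - a} = Ioi (t + a) ×ˢ Ioi (t + a) := by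
      ext p
      simp [lt_sub_iff_add_lt]
    rw [this, measureReal_prod_prod, hIoi, sq]
  simp_rw [e6] at e5
  have e7 : ∫ t in Ioi (0:ℝ), (1 - F (t + a)) ^ 2 = ∫ t in Ioc (0:ℝ) (b - a), (1 - F (t + a)) ^ 2 := by
    apply setIntegral_eq_of_subset_of_forall_sdiff_eq_zero measurableSet_Ioi Ioc_subset_Ioi_self
    rintro x ⟨hx, hx'⟩
    have : b ≤ x + a := by
      by_contra h
      exact hx' ⟨hx, by linarith⟩
    simp [h1 _ this]
  have e8 : ∫ t in Ioc (0:ℝ) (b - a), (1 - F (t + a)) ^ 2 = ∫ x in a..b, (1 - F x) ^ 2 := by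
    rw [← intervalIntegral.integral_of_le (by linarith),
      intervalIntegral.integral_comp_add_right (fun x => (1 - F x) ^ 2)]
    simp
  rw [← e8, ← e7, ← e5, e4]
  ring

theorem IsCdfOn.comb {a b : ℝ} {F G : ℝ → ℝ} (hF : IsCdfOn a b F) (hG : IsCdfOn a b G)
    {α : ℝ} (hα : α ∈ Set.Icc (0 : ℝ) 1) :
    IsCdfOn a b (fun x => α * F x + (1 - α) * G x) := by
  obtain ⟨h0, h1⟩ := hα
  refine ⟨fun x y h => ?_, fun x => ?_, fun x hx => ?_, fun x hx => ?_⟩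
  · exact add_le_add (mul_le_mul_of_nonneg_left (hF.1 h) h0)
      (mul_le_mul_of_nonneg_left (hG.1 h) (by linarith))
  · exact (continuousWithinAt_const.mul (hF.2.1 x)).add
      (continuousWithinAt_const.mul (hG.2.1 x))
  · simp [hF.2.2.1 x hx, hG.2.2.1 x hx]
  · simp [hF.2.2.2 x hx, hG.2.2.2 x hx]

theorem IsCdfOn.intble {a b : ℝ} {F : ℝ → ℝ} (hF : IsCdfOn a b F) :
    IntervalIntegrable (fun x => (1 - F x) ^ 2) volume a b := by
  have hle : ∀ x, F x ≤ 1 := fun x =>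
    (hF.1 (le_max_left x b)).trans (hF.2.2.2 _ (le_max_right x b)).le
  apply Antitone.intervalIntegrable
  intro x y h
  exact pow_le_pow_left₀ (sub_nonneg.2 (hle y)) (sub_le_sub_left (hF.1 h) 1) 2

/-- Example 1 of the paper: the Gini-welfare measure satisfies
`W(F) = a + ∫_a^b (1 − F(x))² dx` for every cdf `F` on `[a,b]`, and is consequently
quasi-convex on `D_cdf([a,b])`. -/
theorem giniWelfare_eq_and_quasiconvex (a b : ℝ) (hab : a < b) :
    (∀ F : ℝ → ℝ, IsCdfOn a b F →
        giniWelfare F = a + ∫ x in a..b, (1 - F x) ^ 2) ∧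
    (∀ F G : ℝ → ℝ, IsCdfOn a b F → IsCdfOn a b G → ∀ α : ℝ, α ∈ Set.Icc (0 : ℝ) 1 →
        giniWelfare (fun x => α * F x + (1 - α) * G x) ≤ max (giniWelfare F) (giniWelfare G)) := by
  refine ⟨fun F hF => welfare_eq a b hab F hF, fun F G hF hG α hα => ?_⟩
  have hC := hF.comb hG hα
  have key : giniWelfare (fun x => α * F x + (1 - α) * G x)
      ≤ α * giniWelfare F + (1 - α) * giniWelfare G := by
    rw [welfare_eq a b hab _ hC, welfare_eq a b hab F hF, welfare_eq a b hab G hG]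
    have hm : ∫ x in a..b, (1 - (α * F x + (1 - α) * G x)) ^ 2
        ≤ ∫ x in a..b, (α * (1 - F x) ^ 2 + (1 - α) * (1 - G x) ^ 2) := by
      apply intervalIntegral.integral_mono_on hab.le hC.intble
        ((hF.intble.const_mul α).add (hG.intble.const_mul (1 - α)))
      intro x _
      nlinarith [mul_nonneg (mul_nonneg hα.1 (sub_nonneg.2 hα.2)) (sq_nonneg (F x - G x))]
    rw [intervalIntegral.integral_add (hF.intble.const_mul α) (hG.intble.const_mul (1 - α)),
      intervalIntegral.integral_const_mul, intervalIntegral.integral_const_mul] at hm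
    linarith
  refine key.trans ?_
  nlinarith [mul_le_mul_of_nonneg_left (le_max_left (giniWelfare F) (giniWelfare G)) hα.1,
    mul_le_mul_of_nonneg_left (le_max_right (giniWelfare F) (giniWelfare G)) (sub_nonneg.2 hα.2)]

end TRDT
end
end
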